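/- arXiv:math/9406212 — 5 statements merged into one kernel-verified Lean document; each statement's English description precedes it below -/
import Mathlib

section
/- Let $t \ge 0$ and set $a(t) = \tfrac12 + \tfrac{e^t + e^{-t}}{4}$. For every measurable function $g$ on a probability space $(\Omega,\Sigma,\mu)$ with $0 \le g \le 1$, one has $\Big(\int_\Omega \min\big(e^t, \tfrac{1}{g(\omega)}\big)\, d\mu(\omega)\Big)\Big(\int_\Omega g(\omega)\, d\mu(\omega)\Big) \le a(t)$ (with the convention $1/0 = +\infty$, so that $\min(e^t, 1/g) = e^t$ where $g = 0$). -/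
open MeasureTheory ENNReal

/-- Where `c⁻¹ ≤ x ≤ 1` this is the convexity bound for `x⁻¹ + c * x`. -/
lemma min_inv_add_mul_le_one_add {c x : ℝ} (hx0 : 0 < x) (hx1 : x ≤ 1) :
    min c x⁻¹ + c * x ≤ 1 + c := by
  have hxx : x * x⁻¹ = 1 := mul_inv_cancel₀ hx0.ne'
  have hinv : 0 < x⁻¹ := inv_pos.mpr hx0
  rcases le_total c x⁻¹ with h | h
  · rw [min_eq_left h]
    nlinarith
  · rw [min_eq_right h]
    nlinarith [mul_nonneg (sub_nonneg.mpr h) (sub_nonneg.mpr hx1)]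

lemma ENNReal.min_ofReal_inv_add_mul_le {c x : ℝ} (hc : 0 ≤ c) (hx0 : 0 ≤ x) (hx1 : x ≤ 1) :
    min (ENNReal.ofReal c) (ENNReal.ofReal x)⁻¹ + ENNReal.ofReal c * ENNReal.ofReal x ≤
      ENNReal.ofReal (1 + c) := by
  rcases hx0.eq_or_lt with rfl | hx
  · simpa using ENNReal.ofReal_le_ofReal (by linarith : c ≤ 1 + c)
  · rw [← ENNReal.ofReal_inv_of_pos hx, ← ENNReal.ofReal_min, ← ENNReal.ofReal_mul hc,
      ← ENNReal.ofReal_add (le_min hc (inv_nonneg.mpr hx0)) (mul_nonneg hc hx0)]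
    exact ENNReal.ofReal_le_ofReal (min_inv_add_mul_le_one_add hx hx1)

/-- The inequality of arithmetic and geometric means for `a` and `c * b`. -/
lemma ENNReal.mul_le_of_add_ofReal_mul_le {a b : ℝ≥0∞} {c d : ℝ} (hc : 0 < c) (hd : 0 ≤ d)
    (h : a + ENNReal.ofReal c * b ≤ ENNReal.ofReal d) :
    a * b ≤ ENNReal.ofReal (d ^ 2 / (4 * c)) := by
  have ha : a ≠ ∞ := ne_top_of_le_ne_top ENNReal.ofReal_ne_top (le_self_add.trans h)
  have hb : b ≠ ∞ := by
    rintro rfl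
    simp [hc] at h
  lift a to NNReal using ha
  lift b to NNReal using hb
  rw [← ENNReal.ofReal_coe_nnreal (p := a), ← ENNReal.ofReal_coe_nnreal (p := b)] at h ⊢
  rw [← ENNReal.ofReal_mul hc.le,
    ← ENNReal.ofReal_add a.coe_nonneg (mul_nonneg hc.le b.coe_nonneg),
    ENNReal.ofReal_le_ofReal_iff hd] at h
  rw [← ENNReal.ofReal_mul a.coe_nonneg]
  refine ENNReal.ofReal_le_ofReal ((le_div_iff₀ (by positivity)).mpr ?_)
  have hsq : ((a : ℝ) + c * b) ^ 2 ≤ d ^ 2 := by gcongr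
  nlinarith [sq_nonneg ((a : ℝ) - c * b)]

/-- Lemma 2.1.2 of Talagrand: for a probability space `(Ω, μ)`, `t ≥ 0`,
`a(t) = 1/2 + (e^t + e^{-t})/4`, and any measurable `g` with `0 ≤ g ≤ 1`,
`(∫ min(e^t, 1/g) dμ) (∫ g dμ) ≤ a(t)`, with the convention `1/0 = ∞`
(handled by working in `ℝ≥0∞`, where `(ofReal 0)⁻¹ = ∞`). -/
theorem talagrand_stmt0 {Ω : Type*} [MeasurableSpace Ω] (μ : Measure Ω)
    [IsProbabilityMeasure μ] (t : ℝ) (ht : 0 ≤ t)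
    (g : Ω → ℝ) (hg : Measurable g) (hg0 : ∀ ω, 0 ≤ g ω) (hg1 : ∀ ω, g ω ≤ 1) :
    (∫⁻ ω, min (ENNReal.ofReal (Real.exp t)) (ENNReal.ofReal (g ω))⁻¹ ∂μ) *
      (∫⁻ ω, ENNReal.ofReal (g ω) ∂μ) ≤
      ENNReal.ofReal (1 / 2 + (Real.exp t + Real.exp (-t)) / 4) := by
  have hsum : (∫⁻ ω, min (ENNReal.ofReal (Real.exp t)) (ENNReal.ofReal (g ω))⁻¹ ∂μ) +
      ENNReal.ofReal (Real.exp t) * ∫⁻ ω, ENNReal.ofReal (g ω) ∂μ ≤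
      ENNReal.ofReal (1 + Real.exp t) := by
    rw [← lintegral_const_mul _ hg.ennreal_ofReal,
      ← lintegral_add_right _ (hg.ennreal_ofReal.const_mul _)]
    calc
      _ ≤ ∫⁻ _, ENNReal.ofReal (1 + Real.exp t) ∂μ := lintegral_mono fun ω =>
        ENNReal.min_ofReal_inv_add_mul_le (Real.exp_pos t).le (hg0 ω) (hg1 ω)
      _ = _ := by simp
  convert ENNReal.mul_le_of_add_ofReal_mul_le (Real.exp_pos t) (by positivity) hsum using 2
  rw [Real.exp_neg]
  field_simp
  ring
end

section
/- Let $(\Omega,\Sigma,\mu)$ be a probability space, $N \ge 1$, and $P = \mu^{\otimes N}$ the product probability on $\Omega^N$. For a measurable $A \subseteq \Omega^N$ with $P(A) > 0$ and every $t > 0$: $\int^* e^{t f(A,x)}\, dP(x) \le \frac{1}{P(A)}\Big(\tfrac12 + \tfrac{e^t+e^{-t}}{4}\Big)^N \le \frac{1}{P(A)} e^{t^2 N/4}$. Consequently, for every $k > 0$, $P^*(\{x : f(A,x) \ge k\}) \le \frac{1}{P(A)} e^{-k^2/N}$. -/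
open MeasureTheory ENNReal

/-- The upper (outer) integral: infimum of `∫⁻ g` over measurable `g ≥ f`. -/
noncomputable def upperLintegral {α : Type*} [MeasurableSpace α] (μ : Measure α)
    (f : α → ℝ≥0∞) : ℝ≥0∞ :=
  ⨅ (g : α → ℝ≥0∞) (_ : Measurable g) (_ : ∀ x, f x ≤ g x), ∫⁻ x, g x ∂μ

/-- The product probability `μ^{⊗N}` on `Ω^N`. -/
noncomputable def piP {Ω : Type*} [MeasurableSpace Ω] (μ : Measure Ω) [SigmaFinite μ]
    (N : ℕ) : Measure (Fin N → Ω) :=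
  Measure.pi fun _ : Fin N => μ

/-- `f(A, x)`: the Hamming distance from `x` to the set `A`. -/
noncomputable def hamDistSet {N : ℕ} {Ω : Type*} (A : Set (Fin N → Ω))
    (x : Fin N → Ω) : ℝ :=
  ⨅ y : A, (Nat.card {i : Fin N // x i ≠ (y : Fin N → Ω) i} : ℝ)

/-- The Hamming weight `a ^ card {i | x i ≠ y i}`, written as a product over the coordinates. -/
noncomputable def hamWeight {N : ℕ} {Ω : Type*} (a : ℝ≥0∞) (x y : Fin N → Ω) : ℝ≥0∞ :=
  open Classical in ∏ i, if x i = y i then 1 else a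

lemma hamWeight_succ {N : ℕ} {Ω : Type*} (a : ℝ≥0∞) (x y : Fin (N + 1) → Ω) :
    hamWeight a x y =
      (open Classical in if x 0 = y 0 then 1 else a) * hamWeight a (Fin.tail x) (Fin.tail y) := by
  rw [hamWeight, Fin.prod_univ_succ]
  rfl

lemma hamWeight_eq_pow {N : ℕ} {Ω : Type*} (a : ℝ≥0∞) (x y : Fin N → Ω) :
    hamWeight a x y = a ^ Nat.card {i : Fin N // x i ≠ y i} := by
  classical
  rw [hamWeight, Finset.prod_ite, Finset.prod_const_one, one_mul, Finset.prod_const,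
    Nat.card_eq_fintype_card, Fintype.card_subtype]

lemma measurable_essInf_right {T Ω : Type*} [MeasurableSpace T] [MeasurableSpace Ω]
    (μ : Measure Ω) [SFinite μ] {g : T × Ω → ℝ≥0∞} (hg : Measurable g) :
    Measurable fun s => essInf (fun ω => g (s, ω)) μ := by
  refine measurable_of_Iio fun c => ?_
  have h : (fun s => essInf (fun ω => g (s, ω)) μ) ⁻¹' Set.Iio c =
      {s | μ (Prod.mk s ⁻¹' (g ⁻¹' Set.Iio c)) = 0}ᶜ := by
    ext s
    simp only [Set.mem_preimage, Set.mem_Iio, Set.mem_compl_iff, Set.mem_ofPred_eq]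
    rw [← not_le, not_iff_not]
    have hae : μ (Prod.mk s ⁻¹' (g ⁻¹' Set.Iio c)) = 0 ↔ ∀ᵐ ω ∂μ, c ≤ g (s, ω) := by
      rw [ae_iff]
      simp only [not_le]
      rfl
    rw [hae]
    constructor
    · intro hc
      filter_upwards [ae_essInf_le (μ := μ) (f := fun ω => g (s, ω))] with ω hω
      exact hc.trans hω
    · exact fun hc => le_essInf_of_ae_le c hc
  rw [h]
  exact (measurable_measure_prodMk_left (hg measurableSet_Iio) (measurableSet_singleton 0)).compl

lemma min_inv_add_mul_le {a u : ℝ≥0∞} (ha1 : 1 ≤ a) (ha : a ≠ ∞) (hu : u ≤ 1) :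
    min u⁻¹ a + a * u ≤ 1 + a := by
  have hut : u ≠ ∞ := (hu.trans_lt one_lt_top).ne
  rcases le_total (a * u) 1 with h | h
  · calc min u⁻¹ a + a * u ≤ a + 1 := add_le_add (min_le_right _ _) h
      _ = 1 + a := add_comm _ _
  · have hu0 : u ≠ 0 := by rintro rfl; simp at h
    refine (add_le_add_left (min_le_left _ _) _).trans ?_
    lift a to NNReal using ha
    lift u to NNReal using hut
    have hu0' : u ≠ 0 := by exact_mod_cast hu0
    rw [← ENNReal.coe_inv hu0']
    norm_cast at *
    have hr : (u : ℝ)⁻¹ + a * u ≤ 1 + a := by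
      have h1 : (u : ℝ) ≤ 1 := by exact_mod_cast hu
      have h2 : (1 : ℝ) ≤ a * u := by exact_mod_cast h
      have h3 : (0 : ℝ) < u := by positivity
      have h4 : 1 + (a : ℝ) - ((u : ℝ)⁻¹ + a * u) = (1 - u) * (a * u - 1) / u := by
        field_simp
        ring
      have h5 : 0 ≤ (1 - (u : ℝ)) * (a * u - 1) / u :=
        div_nonneg (mul_nonneg (by linarith) (by linarith)) h3.le
      linarith
    exact_mod_cast hr

lemma mul_le_of_add_mul_le {t : ℝ} {I J : ℝ≥0∞}
    (h : I + ENNReal.ofReal (Real.exp t) * J ≤ 1 + ENNReal.ofReal (Real.exp t)) :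
    I * J ≤ ENNReal.ofReal (1 / 2 + (Real.exp t + Real.exp (-t)) / 4) := by
  have hpos := Real.exp_pos t
  have hfin : I + ENNReal.ofReal (Real.exp t) * J ≠ ∞ :=
    (h.trans_lt (add_lt_top.2 ⟨one_lt_top, ofReal_lt_top⟩)).ne
  have hI : I ≠ ∞ := fun h' => hfin (by simp [h'])
  have hJ : J ≠ ∞ := by
    rintro rfl
    exact hfin (by rw [ENNReal.mul_top (by simpa using hpos)]; simp)
  lift I to NNReal using hI
  lift J to NNReal using hJ
  have hr : (I : ℝ) + Real.exp t * J ≤ 1 + Real.exp t := by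
    have := ENNReal.toReal_mono (by finiteness) h
    rw [ENNReal.toReal_add (by finiteness) (by finiteness),
      ENNReal.toReal_add (by finiteness) (by finiteness), ENNReal.toReal_mul,
      ENNReal.toReal_ofReal hpos.le] at this
    simpa using this
  have key : (I : ℝ) * J ≤ 1 / 2 + (Real.exp t + Real.exp (-t)) / 4 := by
    rw [Real.exp_neg]
    have h1 : 1 / 2 + (Real.exp t + (Real.exp t)⁻¹) / 4 =
        (1 + Real.exp t) ^ 2 / (4 * Real.exp t) := by
      field_simp
      ring
    rw [h1, le_div_iff₀ (by positivity)]
    have h2 : ((I : ℝ) + Real.exp t * J) ^ 2 ≤ (1 + Real.exp t) ^ 2 :=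
      pow_le_pow_left₀ (by positivity) hr 2
    nlinarith [sq_nonneg ((I : ℝ) - Real.exp t * J)]
  rw [← ENNReal.coe_mul, ← ENNReal.ofReal_coe_nnreal]
  exact ENNReal.ofReal_le_ofReal (by exact_mod_cast key)

lemma lintegral_min_inv_mul_lintegral_le {Ω : Type*} [MeasurableSpace Ω] (μ : Measure Ω)
    [IsProbabilityMeasure μ] {t : ℝ} (ht : 0 ≤ t) {u : Ω → ℝ≥0∞} (hu : Measurable u)
    (hu1 : ∀ᵐ ω ∂μ, u ω ≤ 1) :
    (∫⁻ ω, min (u ω)⁻¹ (ENNReal.ofReal (Real.exp t)) ∂μ) * ∫⁻ ω, u ω ∂μ ≤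
      ENNReal.ofReal (1 / 2 + (Real.exp t + Real.exp (-t)) / 4) := by
  refine mul_le_of_add_mul_le ?_
  rw [← lintegral_const_mul _ hu, ← lintegral_add_right _ (hu.const_mul _)]
  calc _ ≤ ∫⁻ _, 1 + ENNReal.ofReal (Real.exp t) ∂μ := by
        refine lintegral_mono_ae ?_
        filter_upwards [hu1] with ω hω
        exact min_inv_add_mul_le (by simpa using ht) ofReal_ne_top hω
    _ = _ := by simp

lemma lintegral_min_inv_le {Ω : Type*} [MeasurableSpace Ω] (μ : Measure Ω)
    [IsProbabilityMeasure μ] {t : ℝ} (ht : 0 ≤ t) {q : Ω → ℝ≥0∞} (hq : Measurable q)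
    {M : ℝ≥0∞} (hM : ∀ᵐ ω ∂μ, M ≤ (q ω)⁻¹) :
    ∫⁻ ω, min (q ω)⁻¹ (ENNReal.ofReal (Real.exp t) * M) ∂μ ≤
      ENNReal.ofReal (1 / 2 + (Real.exp t + Real.exp (-t)) / 4) * (∫⁻ ω, q ω ∂μ)⁻¹ := by
  have hc : ENNReal.ofReal (1 / 2 + (Real.exp t + Real.exp (-t)) / 4) ≠ 0 := by
    have : 0 < 1 / 2 + (Real.exp t + Real.exp (-t)) / 4 := by positivity
    simpa using this
  rcases eq_or_ne M 0 with rfl | hM0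
  · simp
  rcases eq_or_ne M ∞ with rfl | hMt
  · have : ∫⁻ ω, q ω ∂μ = 0 := by
      rw [lintegral_eq_zero_iff hq]
      filter_upwards [hM] with ω hω
      simpa using hω
    rw [this, ENNReal.inv_zero, ENNReal.mul_top hc]
    exact le_top
  have hu1 : ∀ᵐ ω ∂μ, M * q ω ≤ 1 := by
    filter_upwards [hM] with ω hω
    exact (mul_le_mul_left hω _).trans (ENNReal.inv_mul_le_one _)
  have key := lintegral_min_inv_mul_lintegral_le μ ht (hq.const_mul M) hu1
  have hmin : ∀ ω, min (q ω)⁻¹ (ENNReal.ofReal (Real.exp t) * M) =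
      M * min (M * q ω)⁻¹ (ENNReal.ofReal (Real.exp t)) := by
    intro ω
    rw [mul_min, ENNReal.mul_inv (Or.inl hM0) (Or.inl hMt), ← mul_assoc,
      ENNReal.mul_inv_cancel hM0 hMt, one_mul, mul_comm M]
  simp_rw [hmin]
  rw [lintegral_const_mul' _ _ hMt, ← div_eq_mul_inv]
  rw [lintegral_const_mul _ hq] at key
  refine ENNReal.le_div_iff_mul_le (Or.inr hc) (Or.inr ofReal_ne_top) |>.2 ?_
  calc _ = _ := by ring
    _ ≤ _ := key

lemma lintegral_essInf_le {X Ω : Type*} [MeasurableSpace X] [MeasurableSpace Ω]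
    (ν : Measure X) [SFinite ν] (μ : Measure Ω) [SFinite μ] {g : X × Ω → ℝ≥0∞}
    (hg : Measurable g) :
    ∀ᵐ ω ∂μ, ∫⁻ x, essInf (fun ω' => g (x, ω')) μ ∂ν ≤ ∫⁻ x, g (x, ω) ∂ν := by
  have hs : MeasurableSet {p : X × Ω | essInf (fun ω' => g (p.1, ω')) μ ≤ g p} :=
    measurableSet_le ((measurable_essInf_right μ hg).comp measurable_fst) hg
  have h1 : ∀ᵐ p ∂(ν.prod μ), essInf (fun ω' => g (p.1, ω')) μ ≤ g p :=
    (Measure.ae_prod_iff_ae_ae hs).2 (Filter.Eventually.of_forall fun x =>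
      ae_essInf_le (μ := μ) (f := fun ω => g (x, ω)))
  have h2 : ∀ᵐ ω ∂μ, ∀ᵐ x ∂ν, essInf (fun ω' => g (x, ω')) μ ≤ g (x, ω) :=
    (Measure.ae_ae_comm hs).1 (Measure.ae_ae_of_ae_prod h1)
  filter_upwards [h2] with ω hω using lintegral_mono_ae hω

lemma lintegral_piP_succ {Ω : Type*} [MeasurableSpace Ω] (μ : Measure Ω)
    [IsProbabilityMeasure μ] (N : ℕ) {g : Ω × (Fin N → Ω) → ℝ≥0∞} (hg : Measurable g) :
    ∫⁻ x, g (x 0, Fin.tail x) ∂(piP μ (N + 1)) = ∫⁻ ω, ∫⁻ z, g (ω, z) ∂(piP μ N) ∂μ := by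
  have h := measurePreserving_piFinSuccAbove (fun _ : Fin (N + 1) => μ) 0
  have h' := h.lintegral_comp hg
  rw [lintegral_prod _ hg.aemeasurable] at h'
  exact h'

instance isProbabilityMeasure_piP {Ω : Type*} [MeasurableSpace Ω] (μ : Measure Ω)
    [IsProbabilityMeasure μ] (N : ℕ) : IsProbabilityMeasure (piP μ N) := by
  unfold piP
  infer_instance

lemma measurable_fin_cons {Ω : Type*} [MeasurableSpace Ω] (N : ℕ) :
    Measurable fun p : Ω × (Fin N → Ω) => (Fin.cons p.1 p.2 : Fin (N + 1) → Ω) := by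
  refine measurable_pi_lambda _ fun i => ?_
  refine Fin.cases ?_ (fun j => ?_) i
  · exact measurable_fst
  · exact (measurable_pi_apply j).comp measurable_snd

lemma piP_succ_apply {Ω : Type*} [MeasurableSpace Ω] (μ : Measure Ω)
    [IsProbabilityMeasure μ] (N : ℕ) {A : Set (Fin (N + 1) → Ω)} (hA : MeasurableSet A) :
    piP μ (N + 1) A = ∫⁻ ω, piP μ N {z | (Fin.cons ω z : Fin (N + 1) → Ω) ∈ A} ∂μ := by
  have hcons := measurable_fin_cons (Ω := Ω) N
  have h1 := lintegral_piP_succ μ N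
    (g := fun p => A.indicator (fun _ => (1 : ℝ≥0∞)) (Fin.cons p.1 p.2))
    ((measurable_const.indicator hA).comp hcons)
  simp only [Fin.cons_self_tail] at h1
  rw [lintegral_indicator_const hA, one_mul] at h1
  rw [h1]
  refine lintegral_congr fun ω => ?_
  have hs : MeasurableSet {z | (Fin.cons ω z : Fin (N + 1) → Ω) ∈ A} :=
    (hcons.comp measurable_prodMk_left) hA
  have h2 := lintegral_indicator_const (μ := piP μ N) hs 1
  rw [one_mul] at h2
  exact h2

lemma lintegral_piP_succ_min_le {Ω : Type*} [MeasurableSpace Ω] (μ : Measure Ω)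
    [IsProbabilityMeasure μ] {t : ℝ} (ht : 0 ≤ t) {N : ℕ} {A : Set (Fin (N + 1) → Ω)}
    (hA : MeasurableSet A) {G : Ω × (Fin N → Ω) → ℝ≥0∞} (hG : Measurable G) {K : ℝ≥0∞}
    (hK0 : K ≠ 0) (hK : K ≠ ∞)
    (hGint : ∀ ω, ∫⁻ z, G (ω, z) ∂(piP μ N) ≤
      K * (piP μ N {z | (Fin.cons ω z : Fin (N + 1) → Ω) ∈ A})⁻¹) :
    ∫⁻ x, min (G (x 0, Fin.tail x))
        (ENNReal.ofReal (Real.exp t) * essInf (fun ω => G (ω, Fin.tail x)) μ) ∂(piP μ (N + 1)) ≤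
      K * (ENNReal.ofReal (1 / 2 + (Real.exp t + Real.exp (-t)) / 4) *
        (piP μ (N + 1) A)⁻¹) := by
  have hGswap : Measurable fun p : (Fin N → Ω) × Ω => G (p.2, p.1) := hG.comp measurable_swap
  have hE : Measurable fun z => essInf (fun ω => G (ω, z)) μ :=
    measurable_essInf_right μ (g := fun p : (Fin N → Ω) × Ω => G (p.2, p.1)) hGswap
  have hq : Measurable fun ω => piP μ N {z | (Fin.cons ω z : Fin (N + 1) → Ω) ∈ A} :=
    measurable_measure_prodMk_left (measurable_fin_cons N hA)
  have hEint := lintegral_essInf_le (piP μ N) μ (g := fun p => G (p.2, p.1)) hGswap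
  generalize hI : ∫⁻ z, essInf (fun ω => G (ω, z)) μ ∂(piP μ N) = I at hEint
  have hM : K * (I / K) = I := ENNReal.mul_div_cancel hK0 hK
  have hMq : ∀ᵐ ω ∂μ, I / K ≤ (piP μ N {z | (Fin.cons ω z : Fin (N + 1) → Ω) ∈ A})⁻¹ := by
    filter_upwards [hEint] with ω hω
    exact ENNReal.div_le_of_le_mul' (hω.trans (hGint ω))
  rw [lintegral_piP_succ μ N
    (g := fun p => min (G p) (ENNReal.ofReal (Real.exp t) * essInf (fun ω => G (ω, p.2)) μ))
    (hG.min ((hE.comp measurable_snd).const_mul _)), piP_succ_apply μ N hA]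
  refine le_trans ?_ (mul_le_mul_right (lintegral_min_inv_le μ ht hq hMq) K)
  rw [← lintegral_const_mul' _ _ hK]
  refine lintegral_mono fun ω => ?_
  rw [mul_min]
  refine le_min ?_ ?_
  · exact (lintegral_mono fun z => min_le_left _ _).trans (hGint ω)
  · refine (lintegral_mono fun z => min_le_right _ _).trans ?_
    rw [lintegral_const_mul _ hE, mul_left_comm, hM, hI]

universe u

/-- Measurable majorant of the exponential of the Hamming distance to the sections of a set,
jointly measurable in the parameter. -/
lemma exists_measurable_majorant {Ω : Type u} [MeasurableSpace Ω] (μ : Measure Ω)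
    [IsProbabilityMeasure μ] {t : ℝ} (ht : 0 ≤ t) (N : ℕ) :
    ∀ {T : Type u} [MeasurableSpace T] (A : Set (T × (Fin N → Ω))), MeasurableSet A →
      ∃ G : T × (Fin N → Ω) → ℝ≥0∞, Measurable G ∧
        (∀ s x, ⨅ y ∈ Prod.mk s ⁻¹' A, hamWeight (ENNReal.ofReal (Real.exp t)) x y ≤ G (s, x)) ∧
        ∀ s, ∫⁻ x, G (s, x) ∂(piP μ N) ≤
          ENNReal.ofReal (1 / 2 + (Real.exp t + Real.exp (-t)) / 4) ^ N *
            (piP μ N (Prod.mk s ⁻¹' A))⁻¹ := by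
  set a := ENNReal.ofReal (Real.exp t) with ha
  have hcpos : 0 < 1 / 2 + (Real.exp t + Real.exp (-t)) / 4 := by positivity
  set c := ENNReal.ofReal (1 / 2 + (Real.exp t + Real.exp (-t)) / 4) with hc
  have ha1 : 1 ≤ a := by simpa [ha] using ht
  have hc0 : c ≠ 0 := by simpa [hc] using hcpos
  have hct : c ≠ ∞ := ofReal_ne_top
  induction N with
  | zero =>
    intro T _ A hA
    classical
    refine ⟨A.piecewise 1 fun _ => ∞, measurable_one.piecewise hA measurable_const, ?_, ?_⟩
    · intro s x
      by_cases h : (s, x) ∈ A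
      · refine (iInf₂_le x h).trans ?_
        simp [hamWeight, h]
      · simp [h]
    · intro s
      by_cases h : (s, default) ∈ A
      · have : Prod.mk s ⁻¹' A = Set.univ := by
          ext y
          simpa [Subsingleton.elim y default] using h
        rw [this]
        have hG : ∀ x : Fin 0 → Ω, A.piecewise (1 : T × (Fin 0 → Ω) → ℝ≥0∞)
            (fun _ => ∞) (s, x) = 1 := by
          intro x
          rw [Subsingleton.elim x default]
          simp [h]
        simp [hG]
      · have : Prod.mk s ⁻¹' A = ∅ := by
          ext y
          simpa [Subsingleton.elim y default] using h
        rw [this]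
        simp
  | succ N ih =>
    intro T _ A hA
    have hφ : Measurable fun p : (T × Ω) × (Fin N → Ω) =>
        (p.1.1, (Fin.cons p.1.2 p.2 : Fin (N + 1) → Ω)) :=
      (measurable_fst.comp measurable_fst).prodMk ((measurable_fin_cons N).comp
        ((measurable_snd.comp measurable_fst).prodMk measurable_snd))
    obtain ⟨G, hGm, hGle, hGint⟩ := ih _ (hφ hA)
    have hE : Measurable fun p : T × (Fin N → Ω) => essInf (fun ω => G ((p.1, ω), p.2)) μ :=
      measurable_essInf_right μ (g := fun p : (T × (Fin N → Ω)) × Ω => G ((p.1.1, p.2), p.1.2))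
        (hGm.comp (by fun_prop))
    have htail : Measurable (Fin.tail : (Fin (N + 1) → Ω) → Fin N → Ω) :=
      measurable_pi_lambda _ fun i => measurable_pi_apply i.succ
    have hG0 : Measurable fun p : T × (Fin (N + 1) → Ω) => G ((p.1, p.2 0), Fin.tail p.2) :=
      hGm.comp ((measurable_fst.prodMk ((measurable_pi_apply 0).comp measurable_snd)).prodMk
        (htail.comp measurable_snd))
    have hE0 : Measurable fun p : T × (Fin (N + 1) → Ω) =>
        essInf (fun ω => G ((p.1, ω), Fin.tail p.2)) μ :=
      hE.comp (f := fun p : T × (Fin (N + 1) → Ω) => (p.1, (Fin.tail p.2 : Fin N → Ω)))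
        (measurable_fst.prodMk (htail.comp measurable_snd))
    refine ⟨fun p => min (G ((p.1, p.2 0), Fin.tail p.2))
      (a * essInf (fun ω => G ((p.1, ω), Fin.tail p.2)) μ), hG0.min (hE0.const_mul a), ?_, ?_⟩
    · intro s x
      have hstep : ∀ ω (b : ℝ≥0∞), (open Classical in if x 0 = ω then 1 else a) ≤ b → b ≠ ∞ →
          b ≠ 0 →
          ⨅ y ∈ Prod.mk s ⁻¹' A, hamWeight a x y ≤ b * G ((s, ω), Fin.tail x) := by
        intro ω b hb hbt hb0
        refine le_trans ?_ (mul_le_mul_right (hGle (s, ω) (Fin.tail x)) b)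
        simp_rw [ENNReal.mul_iInf_of_ne hb0 hbt]
        refine le_iInf₂ fun z hz => ?_
        refine (iInf₂_le (Fin.cons ω z) hz).trans ?_
        rw [hamWeight_succ, Fin.cons_zero, Fin.tail_cons]
        exact mul_le_mul_left hb _
      have ha0 : a ≠ 0 := (zero_lt_one.trans_le ha1).ne'
      refine le_min ?_ ?_
      · simpa using hstep (x 0) 1 (by simp) one_ne_top one_ne_zero
      · rw [mul_comm, ← ENNReal.div_le_iff_le_mul (Or.inl ha0) (Or.inl ofReal_ne_top)]
        refine le_essInf_of_ae_le _ (Filter.Eventually.of_forall fun ω => ?_)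
        simp only
        rw [ENNReal.div_le_iff_le_mul (Or.inl ha0) (Or.inl ofReal_ne_top), mul_comm]
        refine hstep ω a ?_ ofReal_ne_top ha0
        split_ifs
        exacts [ha1, le_rfl]
    · intro s
      have hφs : Measurable fun p : Ω × (Fin N → Ω) => ((s, p.1), p.2) := by fun_prop
      rw [pow_succ, mul_assoc]
      exact lintegral_piP_succ_min_le μ ht (measurable_prodMk_left hA) (hGm.comp hφs)
        (pow_ne_zero _ hc0) (pow_ne_top hct) fun ω => hGint (s, ω)

lemma ofReal_exp_hamDistSet_le {N : ℕ} {Ω : Type*} {A : Set (Fin N → Ω)} {t : ℝ} (ht : 0 ≤ t)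
    (x : Fin N → Ω) :
    ENNReal.ofReal (Real.exp (t * hamDistSet A x)) ≤
      ⨅ y ∈ A, hamWeight (ENNReal.ofReal (Real.exp t)) x y := by
  refine le_iInf₂ fun y hy => ?_
  rw [hamWeight_eq_pow, ← ENNReal.ofReal_pow (Real.exp_pos t).le, ← Real.exp_nat_mul, mul_comm _ t]
  refine ENNReal.ofReal_le_ofReal (Real.exp_le_exp.2 (mul_le_mul_of_nonneg_left ?_ ht))
  exact ciInf_le (f := fun y : A => (Nat.card {i : Fin N // x i ≠ (y : Fin N → Ω) i} : ℝ))
    ⟨0, by rintro _ ⟨y, rfl⟩; positivity⟩ ⟨y, hy⟩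

lemma upperLintegral_exp_hamDistSet_le {Ω : Type*} [MeasurableSpace Ω] (μ : Measure Ω)
    [IsProbabilityMeasure μ] {N : ℕ} {A : Set (Fin N → Ω)} (hA : MeasurableSet A)
    {t : ℝ} (ht : 0 ≤ t) :
    upperLintegral (piP μ N) (fun x => ENNReal.ofReal (Real.exp (t * hamDistSet A x))) ≤
      (piP μ N A)⁻¹ * ENNReal.ofReal ((1 / 2 + (Real.exp t + Real.exp (-t)) / 4) ^ N) := by
  obtain ⟨G, hGm, hGle, hGint⟩ := exists_measurable_majorant μ ht N (T := PUnit)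
    (Prod.snd ⁻¹' A) (measurable_snd hA)
  refine iInf_le_of_le (fun x => G (PUnit.unit, x)) (iInf₂_le_of_le
    (hGm.comp measurable_prodMk_left) (fun x => ?_) ?_)
  · exact (ofReal_exp_hamDistSet_le ht x).trans (hGle PUnit.unit x)
  · rw [ENNReal.ofReal_pow (by positivity), mul_comm]
    exact hGint PUnit.unit

lemma half_add_exp_le_exp_sq (t : ℝ) :
    1 / 2 + (Real.exp t + Real.exp (-t)) / 4 ≤ Real.exp (t ^ 2 / 4) := by
  have h1 : 1 / 2 + (Real.exp t + Real.exp (-t)) / 4 = Real.cosh (t / 2) ^ 2 := by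
    have h2 := Real.cosh_sq (t / 2)
    have h3 := Real.cosh_two_mul (t / 2)
    rw [mul_div_cancel₀ t two_ne_zero, Real.cosh_eq] at h3
    linarith
  rw [h1]
  calc Real.cosh (t / 2) ^ 2 ≤ Real.exp ((t / 2) ^ 2 / 2) ^ 2 :=
        pow_le_pow_left₀ (Real.cosh_pos _).le (Real.cosh_le_exp_half_sq _) 2
    _ = Real.exp (t ^ 2 / 4) := by
        rw [← Real.exp_nat_mul]
        congr 1
        push_cast
        ring

lemma ofReal_half_add_exp_pow_le (t : ℝ) (N : ℕ) :
    ENNReal.ofReal ((1 / 2 + (Real.exp t + Real.exp (-t)) / 4) ^ N) ≤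
      ENNReal.ofReal (Real.exp (t ^ 2 * N / 4)) := by
  refine ENNReal.ofReal_le_ofReal ?_
  calc _ ≤ Real.exp (t ^ 2 / 4) ^ N :=
        pow_le_pow_left₀ (by positivity) (half_add_exp_le_exp_sq t) N
    _ = _ := by
        rw [← Real.exp_nat_mul]
        congr 1
        ring

lemma mul_measure_le_upperLintegral {α : Type*} [MeasurableSpace α] (μ : Measure α)
    (f : α → ℝ≥0∞) (b : ℝ≥0∞) : b * μ {x | b ≤ f x} ≤ upperLintegral μ f := by
  refine le_iInf fun g => le_iInf₂ fun hg hfg => ?_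
  refine le_trans ?_ (mul_meas_ge_le_lintegral hg b)
  exact mul_le_mul_right (measure_mono fun x hx => le_trans hx (hfg x)) _

/-- Proposition 2.1.1 of Talagrand: for `t > 0`,
`∫* e^{t f(A,x)} dP ≤ (1/P(A)) (1/2 + (e^t+e^{-t})/4)^N ≤ (1/P(A)) e^{t²N/4}`,
and consequently `P*(f(A,·) ≥ k) ≤ (1/P(A)) e^{-k²/N}`. -/
theorem talagrand_stmt1 {Ω : Type*} [MeasurableSpace Ω] (μ : Measure Ω)
    [IsProbabilityMeasure μ] (N : ℕ) (hN : 1 ≤ N)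
    (A : Set (Fin N → Ω)) (hA : MeasurableSet A) (hA0 : 0 < piP μ N A)
    (t : ℝ) (ht : 0 < t) :
    upperLintegral (piP μ N) (fun x => ENNReal.ofReal (Real.exp (t * hamDistSet A x))) ≤
        (piP μ N A)⁻¹ *
          ENNReal.ofReal ((1 / 2 + (Real.exp t + Real.exp (-t)) / 4) ^ N) ∧
      (piP μ N A)⁻¹ * ENNReal.ofReal ((1 / 2 + (Real.exp t + Real.exp (-t)) / 4) ^ N) ≤
        (piP μ N A)⁻¹ * ENNReal.ofReal (Real.exp (t ^ 2 * N / 4)) ∧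
      ∀ k : ℝ, 0 < k →
        piP μ N {x | k ≤ hamDistSet A x} ≤
          (piP μ N A)⁻¹ * ENNReal.ofReal (Real.exp (-k ^ 2 / N)) := by
  refine ⟨upperLintegral_exp_hamDistSet_le μ hA ht.le,
    mul_le_mul_right (ofReal_half_add_exp_pow_le t N) _, fun k hk => ?_⟩
  have hN0 : (0 : ℝ) < N := by exact_mod_cast hN
  have hr : 0 < 2 * k / N := by positivity
  set r := 2 * k / N with hrdef
  set b := ENNReal.ofReal (Real.exp (r * k)) with hb
  have hb0 : b ≠ 0 := by simpa [hb] using Real.exp_pos (r * k)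
  have hsub : {x | k ≤ hamDistSet A x} ⊆
      {x | b ≤ ENNReal.ofReal (Real.exp (r * hamDistSet A x))} := fun x hx =>
    ENNReal.ofReal_le_ofReal (Real.exp_le_exp.2 (mul_le_mul_of_nonneg_left hx hr.le))
  rw [← ENNReal.mul_le_mul_iff_right hb0 ofReal_ne_top]
  calc b * piP μ N {x | k ≤ hamDistSet A x}
      ≤ b * piP μ N {x | b ≤ ENNReal.ofReal (Real.exp (r * hamDistSet A x))} :=
        mul_le_mul_right (measure_mono hsub) _
    _ ≤ _ := mul_measure_le_upperLintegral _ _ _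
    _ ≤ _ := upperLintegral_exp_hamDistSet_le μ hA hr.le
    _ ≤ (piP μ N A)⁻¹ * ENNReal.ofReal (Real.exp (r ^ 2 * N / 4)) :=
        mul_le_mul_right (ofReal_half_add_exp_pow_le r N) _
    _ = b * ((piP μ N A)⁻¹ * ENNReal.ofReal (Real.exp (-k ^ 2 / N))) := by
        rw [mul_left_comm, hb, ← ENNReal.ofReal_mul (Real.exp_pos _).le, ← Real.exp_add]
        congr 3
        rw [hrdef]
        field_simp
        ring
end

section
/- Let $\Omega = \{0,1\}$, let $\mu$ and $\mu_1$ be probabilities on $\Omega$ with $p = \mu(\{1\})$ and $p_1 = \mu_1(\{1\}) > p$, and let $P = \mu^{\otimes N}$, $P_1 = \mu_1^{\otimes N}$ on $\Omega^N$. For $A \subseteq \Omega^N$ nonempty and $x \in \Omega^N$, set $f(A,x) = \min\{\mathrm{card}\{i \le N : x_i = 1, y_i = 0\} : y \in A\}$. Then for every $\alpha > 0$ and every $t \ge 0$, $\int e^{t f(A,x)}\, dP(x) \le \frac{a(\alpha,t)^N}{P_1(A)^{\alpha}}$, where $a(\alpha,t) = \max\big(1, (1-p+pe^t)(p_1 e^{-t/\alpha}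 + 1 - p_1)^{\alpha}\big)$. In particular, taking $\alpha = 1$ and $e^t = \frac{p_1(1-p)}{p(1-p_1)}$, $\int \Big(\frac{p_1(1-p)}{p(1-p_1)}\Big)^{f(A,x)} dP(x) \le \frac{1}{P_1(A)}$, a bound independent of $N$. -/
open MeasureTheory ENNReal

/-- `f(A,x) = min { card {i ≤ N : x_i = 1, y_i = 0} : y ∈ A }`, with `Ω = {0,1}`
realized as `Bool` (`1 ↔ true`, `0 ↔ false`). -/
noncomputable def fOneZero {N : ℕ} (A : Set (Fin N → Bool)) (x : Fin N → Bool) : ℝ :=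
  ⨅ y : A, (Nat.card {i : Fin N // x i = true ∧ (y : Fin N → Bool) i = false} : ℝ)

/-- The expectation of `g` on `{0,1}^N` when the coordinates are i.i.d. Bernoulli
of parameter `q`. -/
noncomputable def bernoulliExp (q : ℝ) {N : ℕ} (g : (Fin N → Bool) → ℝ) : ℝ :=
  ∑ x, (∏ i, if x i = true then q else 1 - q) * g x

theorem bernoulliExp_succ (q : ℝ) {N : ℕ} (g : (Fin (N + 1) → Bool) → ℝ) :
    bernoulliExp q g = (1 - q) * bernoulliExp q (fun x => g (Fin.cons false x)) +
      q * bernoulliExp q (fun x => g (Fin.cons true x)) := by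
  unfold bernoulliExp
  rw [← (Fin.consEquiv fun _ : Fin (N + 1) => Bool).sum_comp, Fintype.sum_prod_type]
  simp [Fin.consEquiv, Fin.prod_univ_succ, Finset.mul_sum, mul_assoc, add_comm]

theorem bernoulliExp_mono {q : ℝ} (h0 : 0 ≤ q) (h1 : q ≤ 1) {N : ℕ} {g h : (Fin N → Bool) → ℝ}
    (hgh : ∀ x, g x ≤ h x) : bernoulliExp q g ≤ bernoulliExp q h := by
  refine Finset.sum_le_sum fun x _ => mul_le_mul_of_nonneg_left (hgh x) ?_
  refine Finset.prod_nonneg fun i _ => ?_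
  split_ifs <;> linarith

theorem bernoulliExp_const_mul (q c : ℝ) {N : ℕ} (g : (Fin N → Bool) → ℝ) :
    bernoulliExp q (fun x => c * g x) = c * bernoulliExp q g := by
  simp only [bernoulliExp, Finset.mul_sum]
  exact Finset.sum_congr rfl fun x _ => by ring

theorem bernoulliExp_nonneg {q : ℝ} (h0 : 0 ≤ q) (h1 : q ≤ 1) {N : ℕ} {g : (Fin N → Bool) → ℝ}
    (hg : ∀ x, 0 ≤ g x) : 0 ≤ bernoulliExp q g := by
  simpa [bernoulliExp] using bernoulliExp_mono h0 h1 (g := fun _ => 0) hg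

/-- The probability of `A` when the coordinates are i.i.d. Bernoulli
of parameter `q`. -/
noncomputable def bernoulliProb (q : ℝ) {N : ℕ} (A : Set (Fin N → Bool)) : ℝ :=
  bernoulliExp q (A.indicator 1)

theorem bernoulliProb_nonneg {q : ℝ} (h0 : 0 ≤ q) (h1 : q ≤ 1) {N : ℕ}
    (A : Set (Fin N → Bool)) : 0 ≤ bernoulliProb q A :=
  bernoulliExp_nonneg h0 h1 fun _ => Set.indicator_nonneg (fun _ _ => zero_le_one) _

theorem bernoulliProb_pos {q : ℝ} (h0 : 0 < q) (h1 : q < 1) {N : ℕ}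
    {A : Set (Fin N → Bool)} (hA : A.Nonempty) : 0 < bernoulliProb q A := by
  obtain ⟨y, hy⟩ := hA
  have hw : ∀ x : Fin N → Bool, 0 < ∏ i, if x i = true then q else 1 - q := fun x =>
    Finset.prod_pos fun i _ => by split_ifs <;> linarith
  refine Finset.sum_pos' (fun x _ => mul_nonneg (hw x).le
    (Set.indicator_nonneg (fun _ _ => zero_le_one) _)) ⟨y, Finset.mem_univ _, ?_⟩
  simpa [hy] using hw y

theorem nonempty_of_bernoulliProb_pos {q : ℝ} {N : ℕ} {A : Set (Fin N → Bool)}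
    (h : 0 < bernoulliProb q A) : A.Nonempty := by
  rw [Set.nonempty_iff_ne_empty]
  rintro rfl
  simp [bernoulliProb, bernoulliExp] at h

theorem bernoulliProb_succ (q : ℝ) {N : ℕ} (A : Set (Fin (N + 1) → Bool)) :
    bernoulliProb q A = (1 - q) * bernoulliProb q {y | Fin.cons false y ∈ A} +
      q * bernoulliProb q {y | Fin.cons true y ∈ A} :=
  bernoulliExp_succ q _

theorem measure_singleton_bool (μ : Measure Bool) [IsProbabilityMeasure μ] {q : ℝ} (h0 : 0 ≤ q)
    (hμ : μ {true} = ENNReal.ofReal q) (b : Bool) :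
    μ {b} = ENNReal.ofReal (if b = true then q else 1 - q) := by
  cases b
  · have h : ({false} : Set Bool) = {true}ᶜ := by ext b; cases b <;> simp
    rw [h, prob_compl_eq_one_sub (MeasurableSet.singleton _), hμ]
    simp [ENNReal.ofReal_sub 1 h0]
  · simpa using hμ

theorem lintegral_piP (μ : Measure Bool) [IsProbabilityMeasure μ] {q : ℝ} (h0 : 0 ≤ q)
    (h1 : q ≤ 1) (hμ : μ {true} = ENNReal.ofReal q) {N : ℕ} {g : (Fin N → Bool) → ℝ}
    (hg : ∀ x, 0 ≤ g x) :
    ∫⁻ x, ENNReal.ofReal (g x) ∂(piP μ N) = ENNReal.ofReal (bernoulliExp q g) := by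
  have hw : ∀ b : Bool, 0 ≤ if b = true then q else 1 - q := fun b => by
    split_ifs <;> linarith
  rw [lintegral_fintype, bernoulliExp, ENNReal.ofReal_sum_of_nonneg fun x _ =>
    mul_nonneg (Finset.prod_nonneg fun i _ => hw (x i)) (hg x)]
  refine Finset.sum_congr rfl fun x _ => ?_
  rw [piP, Measure.pi_singleton, ENNReal.ofReal_mul (Finset.prod_nonneg fun i _ => hw (x i)),
    ENNReal.ofReal_prod_of_nonneg fun i _ => hw (x i), mul_comm]
  simp only [measure_singleton_bool μ h0 hμ]

theorem piP_apply (μ : Measure Bool) [IsProbabilityMeasure μ] {q : ℝ} (h0 : 0 ≤ q)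
    (h1 : q ≤ 1) (hμ : μ {true} = ENNReal.ofReal q) {N : ℕ} (A : Set (Fin N → Bool)) :
    piP μ N A = ENNReal.ofReal (bernoulliProb q A) := by
  rw [bernoulliProb, ← lintegral_piP μ h0 h1 hμ (g := A.indicator 1) fun _ =>
    Set.indicator_nonneg (fun _ _ => zero_le_one) _,
    ← lintegral_indicator_one MeasurableSet.of_discrete]
  refine lintegral_congr fun x => ?_
  by_cases hx : x ∈ A <;> simp [hx]

theorem natCard_eq_sum {N : ℕ} (x y : Fin N → Bool) :
    (Nat.card {i : Fin N // x i = true ∧ y i = false} : ℝ) =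
      ∑ i, if x i = true ∧ y i = false then 1 else 0 := by
  simp [Nat.card_eq_fintype_card, Fintype.card_subtype]

theorem fOneZero_le_add {N M : ℕ} {A : Set (Fin N → Bool)} {B : Set (Fin M → Bool)}
    (hB : B.Nonempty) {x : Fin N → Bool} {x' : Fin M → Bool} {c : ℝ}
    (h : ∀ y ∈ B, ∃ z ∈ A, (Nat.card {i // x i = true ∧ z i = false} : ℝ) ≤
      Nat.card {i // x' i = true ∧ y i = false} + c) :
    fOneZero A x ≤ fOneZero B x' + c := by
  have := hB.to_subtype
  rw [← sub_le_iff_le_add]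
  refine le_ciInf fun y => ?_
  obtain ⟨z, hz, hle⟩ := h y y.2
  rw [sub_le_iff_le_add]
  exact (ciInf_le (Set.finite_range _).bddBelow (⟨z, hz⟩ : A)).trans hle

theorem fOneZero_cons_le {N : ℕ} {A : Set (Fin (N + 1) → Bool)} (a b : Bool)
    (hA : {y : Fin N → Bool | (Fin.cons b y : Fin (N + 1) → Bool) ∈ A}.Nonempty)
    (x : Fin N → Bool) :
    fOneZero A (Fin.cons a x) ≤
      fOneZero {y : Fin N → Bool | (Fin.cons b y : Fin (N + 1) → Bool) ∈ A} x +
        if a = true ∧ b = false then 1 else 0 := by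
  refine fOneZero_le_add hA fun y hy => ⟨_, hy, ?_⟩
  simp only [natCard_eq_sum, Fin.sum_univ_succ, Fin.cons_zero, Fin.cons_succ]
  exact (add_comm _ _).le

theorem add_mul_rpow_le {q x l : ℝ} (h0 : 0 ≤ q) (h1 : q ≤ 1) (hx : 0 ≤ x) (hl0 : 0 ≤ l)
    (hl1 : l ≤ 1) : 1 - q + q * x ^ l ≤ (1 - q + q * x) ^ l := by
  simpa using (Real.concaveOn_rpow hl0 hl1).2 (Set.mem_Ici.2 zero_le_one) (Set.mem_Ici.2 hx)
    (sub_nonneg.2 h1) h0 (sub_add_cancel 1 q)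

/-- The constant `a(α,t)`. -/
noncomputable def expConst (p p₁ α t : ℝ) : ℝ :=
  max 1 ((1 - p + p * Real.exp t) * (p₁ * Real.exp (-t / α) + 1 - p₁) ^ α)

theorem two_point_le_expConst {p p₁ α t r m : ℝ} (hp0 : 0 ≤ p) (hp1 : p ≤ 1) (hq0 : 0 ≤ p₁)
    (hq1 : p₁ ≤ 1) (hα : 0 < α) (ht : 0 ≤ t) (hr0 : 0 ≤ r) (hr1 : r ≤ 1)
    (hmt : m ≤ Real.exp t) (hmr : m * r ^ α ≤ 1) :
    (1 - p + p * m) * (1 - p₁ + p₁ * r) ^ α ≤ expConst p p₁ α t := by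
  set S := Real.exp (-t / α) with hS
  have hSpos : 0 < S := Real.exp_pos _
  have hbr : 0 ≤ 1 - p₁ + p₁ * r := by nlinarith
  have hbS : 0 ≤ 1 - p₁ + p₁ * S := by nlinarith
  have hat : 0 ≤ 1 - p + p * Real.exp t := by nlinarith [Real.exp_pos t]
  have hform : expConst p p₁ α t =
      max 1 ((1 - p + p * Real.exp t) * (1 - p₁ + p₁ * S) ^ α) := by
    rw [expConst, ← hS, show p₁ * S + 1 - p₁ = 1 - p₁ + p₁ * S by ring]
  rw [hform]
  rcases le_or_gt r S with hrS | hrS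
  · refine le_max_of_le_right ?_
    gcongr
  have hrpos : 0 < r := hSpos.trans hrS
  have htpos : 0 < t := by
    refine lt_of_le_of_ne ht fun h => ?_
    rw [hS, ← h] at hrS
    simp at hrS
    linarith
  have hlog : -t / α < Real.log r := by rwa [Real.lt_log_iff_exp_lt hrpos]
  have hlog0 : Real.log r ≤ 0 := Real.log_nonpos hr0 hr1
  set l := -Real.log r * α / t with hl
  have hl0 : 0 ≤ l := by
    have : 0 ≤ -Real.log r := by linarith
    positivity
  have hl1 : l ≤ 1 := by
    rw [hl, div_le_one htpos]
    rw [div_lt_iff₀ hα] at hlog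
    linarith
  have hrl : r = S ^ l := by
    rw [hS, ← Real.exp_mul, hl, show -t / α * (-Real.log r * α / t) = Real.log r by field_simp,
      Real.exp_log hrpos]
  have hml : m ≤ Real.exp t ^ l := by
    have h1 : Real.exp t ^ l * r ^ α = 1 := by
      rw [Real.rpow_def_of_pos hrpos, ← Real.exp_mul, ← Real.exp_add, hl,
        show t * (-Real.log r * α / t) + Real.log r * α = 0 by field_simp; ring, Real.exp_zero]
    have h2 : 0 < r ^ α := Real.rpow_pos_of_pos hrpos α
    exact le_of_mul_le_mul_right (hmr.trans h1.ge) h2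
  calc (1 - p + p * m) * (1 - p₁ + p₁ * r) ^ α
      ≤ (1 - p + p * Real.exp t) ^ l * ((1 - p₁ + p₁ * S) ^ l) ^ α := by
        gcongr
        · exact (by gcongr : 1 - p + p * m ≤ 1 - p + p * Real.exp t ^ l).trans
            (add_mul_rpow_le hp0 hp1 (Real.exp_pos t).le hl0 hl1)
        · rw [hrl]
          exact add_mul_rpow_le hq0 hq1 hSpos.le hl0 hl1
    _ = ((1 - p + p * Real.exp t) * (1 - p₁ + p₁ * S) ^ α) ^ l := by
        rw [Real.mul_rpow hat (by positivity), ← Real.rpow_mul hbS, ← Real.rpow_mul hbS,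
          mul_comm l]
    _ ≤ (max 1 ((1 - p + p * Real.exp t) * (1 - p₁ + p₁ * S) ^ α)) ^ l := by
        gcongr
        exact le_max_right _ _
    _ ≤ max 1 ((1 - p + p * Real.exp t) * (1 - p₁ + p₁ * S) ^ α) :=
        Real.rpow_le_self_of_one_le (le_max_left _ _) hl1

theorem bernoulliExp_exp_cons_le {p t : ℝ} (hp0 : 0 ≤ p) (hp1 : p ≤ 1) (ht : 0 ≤ t) {N : ℕ}
    {A : Set (Fin (N + 1) → Bool)} (a b : Bool)
    (hA : {y : Fin N → Bool | (Fin.cons b y : Fin (N + 1) → Bool) ∈ A}.Nonempty) :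
    bernoulliExp p (fun x : Fin N → Bool => Real.exp (t * fOneZero A (Fin.cons a x))) ≤
      (if a = true ∧ b = false then Real.exp t else 1) * bernoulliExp p (fun x =>
        Real.exp (t * fOneZero {y : Fin N → Bool | (Fin.cons b y : Fin (N + 1) → Bool) ∈ A} x)) := by
  rw [← bernoulliExp_const_mul]
  refine bernoulliExp_mono hp0 hp1 fun x => ?_
  have h := mul_le_mul_of_nonneg_left (fOneZero_cons_le a b hA x) ht
  refine (Real.exp_le_exp.2 h).trans_eq ?_
  rw [mul_add, Real.exp_add, mul_comm]
  congr 1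
  split_ifs <;> simp

theorem bernoulliExp_exp_mul_bernoulliProb_le {p p₁ α t : ℝ} (hp0 : 0 ≤ p) (hp1 : p ≤ 1)
    (hq0 : 0 < p₁) (hq1 : p₁ < 1) (hα : 0 < α) (ht : 0 ≤ t) (N : ℕ) :
    ∀ A : Set (Fin N → Bool), A.Nonempty →
      bernoulliExp p (fun x => Real.exp (t * fOneZero A x)) * bernoulliProb p₁ A ^ α ≤
        expConst p p₁ α t ^ N := by
  have ha : 1 ≤ expConst p p₁ α t := le_max_left _ _
  induction N with
  | zero =>
    intro A hA
    obtain ⟨y, hy⟩ := hA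
    have hA : A = Set.univ := Set.eq_univ_of_forall fun z => Subsingleton.elim y z ▸ hy
    simp [hA, bernoulliProb, bernoulliExp, fOneZero]
  | succ N ih =>
    intro A hA
    set A₀ : Set (Fin N → Bool) := {y | (Fin.cons false y : Fin (N + 1) → Bool) ∈ A}
    set A₁ : Set (Fin N → Bool) := {y | (Fin.cons true y : Fin (N + 1) → Bool) ∈ A}
    set C := expConst p p₁ α t ^ N with hC
    have hCpos : 0 < C := by positivity
    have hv := bernoulliProb_pos hq0 hq1 hA
    have hv₀ := bernoulliProb_nonneg hq0.le hq1.le A₀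
    have hv₁ := bernoulliProb_nonneg hq0.le hq1.le A₁
    have hsucc : bernoulliProb p₁ A =
        (1 - p₁) * bernoulliProb p₁ A₀ + p₁ * bernoulliProb p₁ A₁ := bernoulliProb_succ p₁ A
    have hcons := fun a b => bernoulliExp_exp_cons_le hp0 hp1 ht (A := A) a b
    have hI : ∀ a, 0 ≤ bernoulliExp p
        (fun x : Fin N → Bool => Real.exp (t * fOneZero A (Fin.cons a x))) :=
      fun a => bernoulliExp_nonneg hp0 hp1 fun _ => (Real.exp_pos _).le
    rw [bernoulliExp_succ, pow_succ, ← hC]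
    set I₀ := bernoulliExp p
      (fun x : Fin N → Bool => Real.exp (t * fOneZero A (Fin.cons false x)))
    set I₁ := bernoulliExp p
      (fun x : Fin N → Bool => Real.exp (t * fOneZero A (Fin.cons true x)))
    set v := bernoulliProb p₁ A
    set v₀ := bernoulliProb p₁ A₀
    set v₁ := bernoulliProb p₁ A₁
    have hI₀ : 0 ≤ I₀ := hI false
    have hI₁ : 0 ≤ I₁ := hI true
    have hbound₁ : ∀ a, A₁.Nonempty → bernoulliExp p
        (fun x : Fin N → Bool => Real.exp (t * fOneZero A (Fin.cons a x))) * v₁ ^ α ≤ C := by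
      intro a h
      have h' := hcons a true h
      simp only [Bool.true_eq_false, and_false, if_false, one_mul] at h'
      exact (mul_le_mul_of_nonneg_right h' (by positivity)).trans (ih A₁ h)
    rcases le_or_gt v₀ v₁ with hle | hlt
    · have hv₁pos : 0 < v₁ := by
        by_contra! hcon
        nlinarith
      have hne := nonempty_of_bernoulliProb_pos hv₁pos
      have hvv : v ≤ v₁ := by nlinarith
      calc ((1 - p) * I₀ + p * I₁) * v ^ α ≤ ((1 - p) * I₀ + p * I₁) * v₁ ^ α := by
            have : 0 ≤ (1 - p) * I₀ + p * I₁ :=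
              add_nonneg (mul_nonneg (sub_nonneg.2 hp1) hI₀) (mul_nonneg hp0 hI₁)
            gcongr
        _ = (1 - p) * (I₀ * v₁ ^ α) + p * (I₁ * v₁ ^ α) := by ring
        _ ≤ (1 - p) * C + p * C :=
            add_le_add (mul_le_mul_of_nonneg_left (hbound₁ false hne) (sub_nonneg.2 hp1))
              (mul_le_mul_of_nonneg_left (hbound₁ true hne) hp0)
        _ = C * 1 := by ring
        _ ≤ C * expConst p p₁ α t := by gcongr
    · have hv₀pos : 0 < v₀ := hv₁.trans_lt hlt
      have hne := nonempty_of_bernoulliProb_pos hv₀pos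
      have hpow : 0 < v₀ ^ α := Real.rpow_pos_of_pos hv₀pos α
      have h₀ : I₀ * v₀ ^ α ≤ C := by
        have h' := hcons false false hne
        simp only [Bool.false_eq_true, false_and, if_false, one_mul] at h'
        exact (mul_le_mul_of_nonneg_right h' hpow.le).trans (ih A₀ hne)
      have h₁ : I₁ * v₀ ^ α ≤ Real.exp t * C := by
        have h' := hcons true false hne
        simp only [and_self, if_true] at h'
        refine (mul_le_mul_of_nonneg_right h' hpow.le).trans ?_
        rw [mul_assoc]
        exact mul_le_mul_of_nonneg_left (ih A₀ hne) (Real.exp_pos t).le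
      have h₁' : I₁ * v₁ ^ α ≤ C := by
        rcases hv₁.eq_or_lt with h | h
        · rw [← h, Real.zero_rpow hα.ne', mul_zero]
          exact hCpos.le
        · exact hbound₁ true (nonempty_of_bernoulliProb_pos h)
      have hkey := two_point_le_expConst (m := I₁ * v₀ ^ α / C) (r := v₁ / v₀) hp0 hp1 hq0.le
        hq1.le hα ht (by positivity) ((div_le_one hv₀pos).2 hlt.le) ((div_le_iff₀ hCpos).2 h₁) (by
          rw [Real.div_rpow hv₁ hv₀pos.le,
            show I₁ * v₀ ^ α / C * (v₁ ^ α / v₀ ^ α) = I₁ * v₁ ^ α / C by field_simp]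
          exact (div_le_one hCpos).2 h₁')
      have hv_eq : v = v₀ * (1 - p₁ + p₁ * (v₁ / v₀)) := by
        rw [hsucc]; field_simp
      have hb : 0 ≤ 1 - p₁ + p₁ * (v₁ / v₀) :=
        add_nonneg (sub_nonneg.2 hq1.le) (by positivity)
      have hb' := Real.rpow_nonneg hb α
      calc ((1 - p) * I₀ + p * I₁) * v ^ α
          = ((1 - p) * (I₀ * v₀ ^ α) + p * (I₁ * v₀ ^ α)) *
              (1 - p₁ + p₁ * (v₁ / v₀)) ^ α := by
            rw [hv_eq, Real.mul_rpow hv₀pos.le hb]; ring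
        _ ≤ ((1 - p) * C + p * (I₁ * v₀ ^ α)) * (1 - p₁ + p₁ * (v₁ / v₀)) ^ α := by
            have := sub_nonneg.2 hp1
            gcongr
        _ = C * ((1 - p + p * (I₁ * v₀ ^ α / C)) * (1 - p₁ + p₁ * (v₁ / v₀)) ^ α) := by
            field_simp
        _ ≤ C * expConst p p₁ α t := by gcongr

theorem lintegral_exp_fOneZero_le (N : ℕ) (μ μ₁ : Measure Bool) [IsProbabilityMeasure μ]
    [IsProbabilityMeasure μ₁] {p p₁ : ℝ} (hp0 : 0 ≤ p) (hp1 : p ≤ 1) (hq0 : 0 < p₁)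
    (hq1 : p₁ < 1) (hμ : μ {true} = ENNReal.ofReal p) (hμ₁ : μ₁ {true} = ENNReal.ofReal p₁)
    {A : Set (Fin N → Bool)} (hA : A.Nonempty) {α t : ℝ} (hα : 0 < α) (ht : 0 ≤ t) :
    ∫⁻ x, ENNReal.ofReal (Real.exp (t * fOneZero A x)) ∂(piP μ N) ≤
      ENNReal.ofReal (expConst p p₁ α t ^ N) * (piP μ₁ N A ^ α)⁻¹ := by
  have hv := bernoulliProb_pos hq0 hq1 hA
  have hpow := Real.rpow_pos_of_pos hv α
  rw [lintegral_piP μ hp0 hp1 hμ fun _ => (Real.exp_pos _).le,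
    piP_apply μ₁ hq0.le hq1.le hμ₁, ENNReal.ofReal_rpow_of_pos hv,
    ← ENNReal.ofReal_inv_of_pos hpow, ← ENNReal.ofReal_mul' (inv_nonneg.2 hpow.le),
    ← div_eq_mul_inv]
  refine ENNReal.ofReal_le_ofReal ((le_div_iff₀ hpow).2 ?_)
  exact bernoulliExp_exp_mul_bernoulliProb_le hp0 hp1 hq0 hq1 hα ht N A hA

theorem expConst_one_log {p p₁ : ℝ} (hp : 0 < p) (hp1 : p < 1) (hq0 : 0 < p₁) (hq1 : p₁ < 1) :
    expConst p p₁ 1 (Real.log (p₁ * (1 - p) / (p * (1 - p₁)))) = 1 := by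
  have h1 : 0 < 1 - p := sub_pos.2 hp1
  have h2 : 0 < 1 - p₁ := sub_pos.2 hq1
  have hR : 0 < p₁ * (1 - p) / (p * (1 - p₁)) := by positivity
  rw [expConst, div_one, Real.exp_neg, Real.exp_log hR, Real.rpow_one]
  refine max_eq_left (le_of_eq ?_)
  field_simp
  ring

/-- Theorem 2.3.4 of Talagrand: for probabilities `μ, μ₁` on `{0,1}` with
`p = μ({1}) < p₁ = μ₁({1})`, a nonempty `A ⊆ {0,1}^N`, every `α > 0` and `t ≥ 0`,
`∫ e^{t f(A,x)} dP ≤ a(α,t)^N / P₁(A)^α` where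
`a(α,t) = max(1, (1-p+pe^t)(p₁ e^{-t/α} + 1 - p₁)^α)`; in particular (taking `α = 1`
and `e^t = p₁(1-p)/(p(1-p₁))`),
`∫ (p₁(1-p)/(p(1-p₁)))^{f(A,x)} dP ≤ 1/P₁(A)`. -/
theorem talagrand_stmt3 (N : ℕ) (hN : 1 ≤ N)
    (μ μ₁ : Measure Bool) [IsProbabilityMeasure μ] [IsProbabilityMeasure μ₁]
    (p p₁ : ℝ) (hp : 0 < p) (hpp : p < p₁) (hp₁ : p₁ < 1)
    (hμ : μ {true} = ENNReal.ofReal p) (hμ₁ : μ₁ {true} = ENNReal.ofReal p₁)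
    (A : Set (Fin N → Bool)) (hA : A.Nonempty) :
    (∀ α : ℝ, 0 < α → ∀ t : ℝ, 0 ≤ t →
      ∫⁻ x, ENNReal.ofReal (Real.exp (t * fOneZero A x)) ∂(piP μ N) ≤
        ENNReal.ofReal
            ((max 1 ((1 - p + p * Real.exp t) *
              (p₁ * Real.exp (-t / α) + 1 - p₁) ^ α)) ^ N) *
          (piP μ₁ N A ^ α)⁻¹) ∧
    ∫⁻ x, ENNReal.ofReal ((p₁ * (1 - p) / (p * (1 - p₁))) ^ fOneZero A x) ∂(piP μ N) ≤
      (piP μ₁ N A)⁻¹ := by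
  have hp1 : p < 1 := hpp.trans hp₁
  have hq0 : 0 < p₁ := hp.trans hpp
  refine ⟨fun α hα t ht => lintegral_exp_fOneZero_le N μ μ₁ hp.le hp1.le hq0 hp₁ hμ hμ₁ hA hα ht,
    ?_⟩
  have h1 : 0 < 1 - p := sub_pos.2 hp1
  have h2 : 0 < 1 - p₁ := sub_pos.2 hp₁
  have hR : 0 < p₁ * (1 - p) / (p * (1 - p₁)) := by positivity
  have hR1 : 1 ≤ p₁ * (1 - p) / (p * (1 - p₁)) := by
    rw [one_le_div (by positivity)]
    nlinarith
  have h := lintegral_exp_fOneZero_le N μ μ₁ hp.le hp1.le hq0 hp₁ hμ hμ₁ hA one_pos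
    (Real.log_nonneg hR1)
  rw [expConst_one_log hp hp1 hq0 hp₁] at h
  simpa [Real.rpow_def_of_pos hR] using h
end

section
/- Let $(\Omega,\Sigma,\mu)$ be a probability space, $N \ge 1$, $P = \mu^{\otimes N}$, and let $h : \Omega \times \Omega \to [0,\infty)$ be measurable with $h(\omega,\omega) = 0$ for all $\omega$. Set $v(\omega,\omega') = \max(h(\omega,\omega'), h(\omega',\omega))$. Then for every measurable $A \subseteq \Omega^N$ with $P(A) > 0$ and every $t > 0$ such that $\iint \exp(t\, h(x,y))\, d\mu(x) d\mu(y) < \infty$: $\int^*_{\Omega^N} e^{t f_h(A,x)}\, dP(x) \le \frac{1}{P(A)} \Big(\tfrac12 \iint_{\Omega^2} \big(e^{t v(\omega,\omega')} + e^{-t v(\omega,\omega')}\big)\, d\mu(\omega) d\mu(\omega')\Big)^N$. -/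
open MeasureTheory ENNReal

/-- `f_h(A,x) = inf { ∑_{i ≤ N} h(x_i, y_i) : y ∈ A }`. -/
noncomputable def fPenalty {N : ℕ} {Ω : Type*} (h : Ω → Ω → ℝ) (A : Set (Fin N → Ω))
    (x : Fin N → Ω) : ℝ :=
  ⨅ y : A, ∑ i, h (x i) ((y : Fin N → Ω) i)

/-- The larger of `g x` and the essential supremum over `y` of `k x y * g y`. -/
noncomputable def kernelEssSup {Ω : Type*} [MeasurableSpace Ω] (μ : Measure Ω)
    (k : Ω → Ω → ℝ≥0∞) (g : Ω → ℝ≥0∞) (x : Ω) : ℝ≥0∞ :=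
  max (g x) (essSup (fun y => k x y * g y) μ)

theorem measurable_essSup_right {Y Ω : Type*} [MeasurableSpace Y] [MeasurableSpace Ω]
    (μ : Measure Ω) [SFinite μ] {f : Y → Ω → ℝ≥0∞} (hf : Measurable (Function.uncurry f)) :
    Measurable fun y => essSup (f y) μ := by
  refine measurable_of_Iic fun c => ?_
  have key : (fun y => essSup (f y) μ) ⁻¹' Set.Iic c =
      {y | μ (Prod.mk y ⁻¹' {p : Y × Ω | c < Function.uncurry f p}) = 0} := by
    ext y
    simp only [Set.mem_preimage, Set.mem_Iic, Set.mem_ofPred_eq]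
    have : essSup (f y) μ ≤ c ↔ ∀ᵐ ω ∂μ, f y ω ≤ c :=
      ⟨fun h => (ENNReal.ae_le_essSup (f y)).mono fun ω hω => hω.trans h,
        fun h => essSup_le_of_ae_le c h⟩
    rw [this, ae_iff]
    simp [Set.preimage, Function.uncurry]
  rw [key]
  exact measurable_measure_prodMk_left (measurableSet_lt measurable_const hf)
    (measurableSet_singleton 0)

theorem measurable_kernelEssSup {Y Ω : Type*} [MeasurableSpace Y] [MeasurableSpace Ω]
    (μ : Measure Ω) [SFinite μ] {k : Ω → Ω → ℝ≥0∞} (hk : Measurable (Function.uncurry k))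
    {g : Y → Ω → ℝ≥0∞} (hg : Measurable (Function.uncurry g)) :
    Measurable fun p : Y × Ω => kernelEssSup μ k (g p.1) p.2 := by
  refine Measurable.max hg (measurable_essSup_right μ
    (f := fun (p : Y × Ω) ω => k p.2 ω * g p.1 ω) ?_)
  exact (hk.comp ((measurable_snd.comp measurable_fst).prodMk measurable_snd)).mul
    (hg.comp ((measurable_fst.comp measurable_fst).prodMk measurable_snd))

theorem measurable_kernelEssSup_right {Ω : Type*} [MeasurableSpace Ω]
    (μ : Measure Ω) [SFinite μ] {k : Ω → Ω → ℝ≥0∞} (hk : Measurable (Function.uncurry k))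
    {g : Ω → ℝ≥0∞} (hg : Measurable g) : Measurable (kernelEssSup μ k g) :=
  (measurable_kernelEssSup μ hk (Y := Unit) (g := fun _ => g)
    (hg.comp measurable_snd)).comp (measurable_const (a := ()) |>.prodMk measurable_id)

theorem lintegral_inv_kernelEssSup_le {Ω : Type*} [MeasurableSpace Ω] (μ : Measure Ω)
    [IsProbabilityMeasure μ] {k : Ω → Ω → ℝ≥0∞} (hk : Measurable (Function.uncurry k))
    (hk1 : ∀ x y, k x y ≤ 1) {W : Ω × Ω → ℝ≥0∞}
    (hW : ∀ x y a b, a ≤ (k x y)⁻¹ → b ≤ (k y x)⁻¹ → a * b ≤ 1 → a + b ≤ W (x, y))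
    (hW0 : 2⁻¹ * ∫⁻ p, W p ∂(μ.prod μ) ≠ 0)
    {g : Ω → ℝ≥0∞} (hg : Measurable g) (hg1 : ∀ x, g x ≤ 1) :
    ∫⁻ x, (kernelEssSup μ k g x)⁻¹ ∂μ ≤
      (2⁻¹ * ∫⁻ p, W p ∂(μ.prod μ)) * (∫⁻ x, g x ∂μ)⁻¹ := by
  set φ : Ω → ℝ≥0∞ := fun x => (kernelEssSup μ k g x)⁻¹ with hφ
  have hφm : Measurable φ :=
    (measurable_kernelEssSup_right μ hk hg).inv
  have hgfin : ∫⁻ x, g x ∂μ ≠ ∞ :=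
    ((lintegral_mono hg1).trans_lt (by simp)).ne
  rw [← div_eq_mul_inv, ENNReal.le_div_iff_mul_le (Or.inr hW0) (Or.inl hgfin)]
  have hdiag : ∀ x, φ x * g x ≤ 1 := fun x => by
    refine le_trans (mul_le_mul_left ?_ _) (ENNReal.inv_mul_le_one (g x))
    exact ENNReal.inv_le_inv.2 (le_max_left _ _)
  have hoff : ∀ x, ∀ᵐ y ∂μ, φ x * g y ≤ (k x y)⁻¹ := fun x => by
    filter_upwards [ENNReal.ae_le_essSup (μ := μ) fun y => k x y * g y] with y hy
    have hle : k x y * g y ≤ kernelEssSup μ k g x := hy.trans (le_max_right _ _)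
    have hkt : k x y ≠ ∞ := ((hk1 x y).trans_lt one_lt_top).ne
    rw [ENNReal.le_inv_iff_mul_le]
    calc φ x * g y * k x y = φ x * (k x y * g y) := by ring
      _ ≤ (kernelEssSup μ k g x)⁻¹ * kernelEssSup μ k g x := mul_le_mul_right hle _
      _ ≤ 1 := ENNReal.inv_mul_le_one _
  have hm1 : Measurable fun p : Ω × Ω => φ p.1 * g p.2 :=
    (hφm.comp measurable_fst).mul (hg.comp measurable_snd)
  have hoff1 : ∀ᵐ p ∂(μ.prod μ), φ p.1 * g p.2 ≤ (k p.1 p.2)⁻¹ :=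
    (Measure.ae_prod_iff_ae_ae (measurableSet_le hm1 hk.inv)).2 (ae_of_all _ hoff)
  have hoff2 : ∀ᵐ p ∂(μ.prod μ), φ p.2 * g p.1 ≤ (k p.2 p.1)⁻¹ :=
    (Measure.measurePreserving_swap (μ := μ) (ν := μ)).quasiMeasurePreserving.ae hoff1
  have e1 : ∫⁻ p, φ p.1 * g p.2 ∂(μ.prod μ) = (∫⁻ x, φ x ∂μ) * ∫⁻ x, g x ∂μ :=
    lintegral_prod_mul hφm.aemeasurable hg.aemeasurable
  have e2 : ∫⁻ p, φ p.2 * g p.1 ∂(μ.prod μ) = (∫⁻ x, φ x ∂μ) * ∫⁻ x, g x ∂μ := by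
    rw [mul_comm, ← lintegral_prod_mul hg.aemeasurable hφm.aemeasurable]
    simp only [mul_comm]
  have hsum : 2 * ((∫⁻ x, φ x ∂μ) * ∫⁻ x, g x ∂μ) ≤ ∫⁻ p, W p ∂(μ.prod μ) := by
    rw [two_mul]
    nth_rewrite 1 [← e1]
    rw [← e2, ← lintegral_add_left hm1]
    refine lintegral_mono_ae ?_
    filter_upwards [hoff1, hoff2] with p h1 h2
    refine hW p.1 p.2 _ _ h1 h2 ?_
    calc φ p.1 * g p.2 * (φ p.2 * g p.1) = (φ p.1 * g p.1) * (φ p.2 * g p.2) := by ring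
      _ ≤ 1 := mul_le_one' (hdiag _) (hdiag _)
  calc (∫⁻ x, φ x ∂μ) * ∫⁻ x, g x ∂μ
      = 2⁻¹ * (2 * ((∫⁻ x, φ x ∂μ) * ∫⁻ x, g x ∂μ)) := by
        rw [← mul_assoc, ENNReal.inv_mul_cancel (by simp) (by simp), one_mul]
    _ ≤ _ := mul_le_mul_right hsum _

theorem kernelEssSup_lintegral_le {X Ω : Type*} [MeasurableSpace X] [MeasurableSpace Ω]
    (ν : Measure X) [SFinite ν] (μ : Measure Ω) [SFinite μ] {k : Ω → Ω → ℝ≥0∞}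
    (hk : Measurable (Function.uncurry k)) {g : X → Ω → ℝ≥0∞}
    (hg : Measurable (Function.uncurry g)) (ω : Ω) :
    kernelEssSup μ k (fun ω' => ∫⁻ x, g x ω' ∂ν) ω ≤ ∫⁻ x, kernelEssSup μ k (g x) ω ∂ν := by
  refine max_le (lintegral_mono fun x => le_max_left _ _) (essSup_le_of_ae_le _ ?_)
  have hm : Measurable fun p : X × Ω => k ω p.2 * g p.1 p.2 :=
    (hk.comp (measurable_const.prodMk measurable_snd)).mul hg
  have hm' : Measurable fun p : X × Ω => kernelEssSup μ k (g p.1) ω :=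
    (measurable_kernelEssSup μ hk hg).comp (measurable_fst.prodMk measurable_const)
  have hae : ∀ᵐ x ∂ν, ∀ᵐ ω' ∂μ, k ω ω' * g x ω' ≤ kernelEssSup μ k (g x) ω :=
    ae_of_all _ fun x => (ENNReal.ae_le_essSup fun ω' => k ω ω' * g x ω').mono
      fun ω' h => h.trans (le_max_right _ _)
  filter_upwards [(Measure.ae_ae_comm
    (p := fun x ω' => k ω ω' * g x ω' ≤ kernelEssSup μ k (g x) ω)
    (measurableSet_le hm hm')).1 hae] with ω' h
  have hgω : Measurable fun x => g x ω' := hg.comp (measurable_id.prodMk measurable_const)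
  rw [← lintegral_const_mul _ hgω]
  exact lintegral_mono_ae h

theorem exists_measurable_le_iSup_prod_kernel.{u} {Ω : Type u} [MeasurableSpace Ω] (μ : Measure Ω)
    [IsProbabilityMeasure μ] {k : Ω → Ω → ℝ≥0∞} (hk : Measurable (Function.uncurry k))
    (hk1 : ∀ x y, k x y ≤ 1) (hkd : ∀ x, k x x = 1)
    {W : Ω × Ω → ℝ≥0∞}
    (hW : ∀ x y a b, a ≤ (k x y)⁻¹ → b ≤ (k y x)⁻¹ → a * b ≤ 1 → a + b ≤ W (x, y))
    (hW0 : 2⁻¹ * ∫⁻ p, W p ∂(μ.prod μ) ≠ 0) (N : ℕ) :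
    ∀ {Y : Type u} [MeasurableSpace Y] {g : Y → (Fin N → Ω) → ℝ≥0∞},
      Measurable (Function.uncurry g) → (∀ y x, g y x ≤ 1) →
      ∃ G : Y → (Fin N → Ω) → ℝ≥0∞, Measurable (Function.uncurry G) ∧
        (∀ y x, G y x ≤ ⨆ x', (∏ i, k (x i) (x' i)) * g y x') ∧
        ∀ y, ∫⁻ x, (G y x)⁻¹ ∂(Measure.pi fun _ => μ) ≤
          (2⁻¹ * ∫⁻ p, W p ∂(μ.prod μ)) ^ N * (∫⁻ x, g y x ∂(Measure.pi fun _ => μ))⁻¹ := by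
  induction N with
  | zero =>
    intro Y _ g hg hg1
    refine ⟨g, hg, fun y x => le_iSup_of_le x (by simp), fun y => ?_⟩
    simp [Measure.pi_of_empty _ default]
  | succ N ih =>
    intro Y _ g hg hg1
    set C := 2⁻¹ * ∫⁻ p, W p ∂(μ.prod μ) with hC
    have hcons : Measurable fun p : Ω × (Fin N → Ω) => (Fin.cons p.1 p.2 : Fin (N + 1) → Ω) := by
      refine measurable_pi_iff.2 fun i => ?_
      refine Fin.cases ?_ (fun j => ?_) i
      · simpa using measurable_fst
      · exact (measurable_pi_apply j).comp measurable_snd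
    have hsplit : ∀ f : (Fin (N + 1) → Ω) → ℝ≥0∞, Measurable f →
        ∫⁻ z, f z ∂(Measure.pi fun _ => μ) =
          ∫⁻ ω, ∫⁻ x, f (Fin.cons ω x) ∂(Measure.pi fun _ => μ) ∂μ := fun f hf => by
      have hmp := (measurePreserving_piFinSuccAbove (fun _ : Fin (N + 1) => μ) 0).symm
      rw [← hmp.lintegral_comp hf, lintegral_prod]
      · refine lintegral_congr fun ω => lintegral_congr fun x => ?_
        simp [MeasurableEquiv.piFinSuccAbove, Fin.consEquiv]
      · exact (hf.comp hmp.measurable).aemeasurable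
    let g' : Y × (Fin N → Ω) → Ω → ℝ≥0∞ := fun p ω => g p.1 (Fin.cons ω p.2)
    have hg' : Measurable (Function.uncurry g') :=
      hg.comp ((measurable_fst.comp measurable_fst).prodMk
        (hcons.comp (measurable_snd.prodMk (measurable_snd.comp measurable_fst))))
    let g₁ : Y × Ω → (Fin N → Ω) → ℝ≥0∞ := fun p x => kernelEssSup μ k (g' (p.1, x)) p.2
    have hg₁ : Measurable (Function.uncurry g₁) :=
      (measurable_kernelEssSup μ hk hg').comp
        (((measurable_fst.comp measurable_fst).prodMk measurable_snd).prodMk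
          (measurable_snd.comp measurable_fst))
    have hg₁sup : ∀ y ω x, g₁ (y, ω) x ≤ ⨆ ω', k ω ω' * g y (Fin.cons ω' x) := fun y ω x =>
      max_le (le_iSup_of_le ω (by simp [hkd, g']))
        (essSup_le_of_ae_le _ (ae_of_all _ fun ω' =>
          le_iSup (fun ω' => k ω ω' * g y (Fin.cons ω' x)) ω'))
    have hg₁1 : ∀ p x, g₁ p x ≤ 1 := fun p x =>
      (hg₁sup p.1 p.2 x).trans (iSup_le fun ω' => mul_le_one' (hk1 _ _) (hg1 _ _))
    obtain ⟨G₁, hG₁, hG₁sup, hG₁int⟩ := ih hg₁ hg₁1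
    have hG : Measurable (Function.uncurry fun (y : Y) (z : Fin (N + 1) → Ω) =>
        G₁ (y, z 0) (Fin.tail z)) := by
      have htail : Measurable fun p : Y × (Fin (N + 1) → Ω) => Fin.tail p.2 :=
        measurable_pi_iff.2 fun i => (measurable_pi_apply i.succ).comp measurable_snd
      have hhead : Measurable fun p : Y × (Fin (N + 1) → Ω) => (p.1, p.2 0) :=
        measurable_fst.prodMk ((measurable_pi_apply 0).comp measurable_snd)
      exact hG₁.comp (hhead.prodMk htail)
    refine ⟨fun y z => G₁ (y, z 0) (Fin.tail z), hG, fun y z => ?_, fun y => ?_⟩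
    · refine (hG₁sup _ _).trans (iSup_le fun x' => ?_)
      refine (mul_le_mul_right (hg₁sup _ _ _) _).trans ?_
      rw [ENNReal.mul_iSup]
      refine iSup_le fun ω' => le_iSup_of_le (Fin.cons ω' x') ?_
      rw [Fin.prod_univ_succ]
      simp only [Fin.cons_zero, Fin.cons_succ, Fin.tail]
      exact le_of_eq (by ring)
    · have hgy : Measurable (g y) := hg.comp (measurable_const.prodMk measurable_id)
      have hGy : Measurable fun z : Fin (N + 1) → Ω => (G₁ (y, z 0) (Fin.tail z))⁻¹ :=
        (hG.comp (measurable_const.prodMk measurable_id)).inv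
      rw [hsplit _ hGy, hsplit _ hgy]
      have hgy' : Measurable (Function.uncurry fun (x : Fin N → Ω) ω => g' (y, x) ω) :=
        hg'.comp ((measurable_const.prodMk measurable_fst).prodMk measurable_snd)
      have hmarg : Measurable fun ω => ∫⁻ x, g' (y, x) ω ∂(Measure.pi fun _ => μ) :=
        Measurable.lintegral_prod_left' hgy'
      calc ∫⁻ ω, ∫⁻ x, (G₁ (y, (Fin.cons ω x : Fin (N + 1) → Ω) 0)
              (Fin.tail (Fin.cons ω x : Fin (N + 1) → Ω)))⁻¹ ∂(Measure.pi fun _ => μ) ∂μ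
          = ∫⁻ ω, ∫⁻ x, (G₁ (y, ω) x)⁻¹ ∂(Measure.pi fun _ => μ) ∂μ := by
            simp only [Fin.cons_zero, Fin.tail_cons]
        _ ≤ ∫⁻ ω, C ^ N * (kernelEssSup μ k
              (fun ω' => ∫⁻ x, g' (y, x) ω' ∂(Measure.pi fun _ => μ)) ω)⁻¹ ∂μ := by
            refine lintegral_mono fun ω => (hG₁int (y, ω)).trans ?_
            exact mul_le_mul_right
              (ENNReal.inv_le_inv.2 (kernelEssSup_lintegral_le _ μ hk hgy' ω)) _
        _ = C ^ N * ∫⁻ ω, (kernelEssSup μ k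
              (fun ω' => ∫⁻ x, g' (y, x) ω' ∂(Measure.pi fun _ => μ)) ω)⁻¹ ∂μ := by
            exact lintegral_const_mul _ (measurable_kernelEssSup_right μ hk hmarg).inv
        _ ≤ C ^ N * (C * (∫⁻ ω, ∫⁻ x, g' (y, x) ω ∂(Measure.pi fun _ => μ) ∂μ)⁻¹) := by
            refine mul_le_mul_right (lintegral_inv_kernelEssSup_le μ hk hk1 hW hW0 hmarg
              fun ω => ?_) _
            exact (lintegral_mono fun x => hg1 _ _).trans (by simp)
        _ = _ := by rw [pow_succ, mul_assoc (C ^ N)]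

theorem add_le_ofReal_exp_add_exp_neg {a b : ℝ≥0∞} {s : ℝ}
    (ha : a ≤ ENNReal.ofReal (Real.exp s)) (hb : b ≤ ENNReal.ofReal (Real.exp s))
    (hab : a * b ≤ 1) :
    a + b ≤ ENNReal.ofReal (Real.exp s) + ENNReal.ofReal (Real.exp (-s)) := by
  lift a to NNReal using (ha.trans_lt ofReal_lt_top).ne
  lift b to NNReal using (hb.trans_lt ofReal_lt_top).ne
  have hE := Real.exp_pos s
  rw [← ENNReal.ofReal_coe_nnreal, ENNReal.ofReal_le_ofReal_iff hE.le] at ha hb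
  have hab' : (a : ℝ) * b ≤ 1 := by exact_mod_cast hab
  rw [← ENNReal.ofReal_add hE.le (Real.exp_pos _).le, ← ENNReal.ofReal_coe_nnreal,
    ← ENNReal.ofReal_coe_nnreal, ← ENNReal.ofReal_add a.coe_nonneg b.coe_nonneg, Real.exp_neg]
  refine ENNReal.ofReal_le_ofReal ?_
  rw [← mul_le_mul_iff_right₀ hE, mul_add, mul_add, mul_inv_cancel₀ hE.ne']
  nlinarith [mul_nonneg (sub_nonneg.2 ha) (sub_nonneg.2 hb)]

/-- Theorem 2.4.1 of Talagrand: with `v(ω,ω') = max(h(ω,ω'), h(ω',ω))`, for all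
measurable `A` with `P(A) > 0` and all `t > 0` with `∬ e^{t h} dμ dμ < ∞`,
`∫* e^{t f_h(A,x)} dP ≤ (1/P(A)) ((1/2) ∬ (e^{t v} + e^{-t v}) dμ dμ)^N`. -/
theorem talagrand_stmt4 {Ω : Type*} [MeasurableSpace Ω] (μ : Measure Ω)
    [IsProbabilityMeasure μ] (N : ℕ) (hN : 1 ≤ N)
    (h : Ω → Ω → ℝ) (hmeas : Measurable fun p : Ω × Ω => h p.1 p.2)
    (hnn : ∀ x y, 0 ≤ h x y) (hdiag : ∀ ω, h ω ω = 0)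
    (A : Set (Fin N → Ω)) (hA : MeasurableSet A) (hA0 : 0 < piP μ N A)
    (t : ℝ) (ht : 0 < t)
    (hfin : ∫⁻ p : Ω × Ω, ENNReal.ofReal (Real.exp (t * h p.1 p.2)) ∂(μ.prod μ) < ⊤) :
    upperLintegral (piP μ N)
        (fun x => ENNReal.ofReal (Real.exp (t * fPenalty h A x))) ≤
      (piP μ N A)⁻¹ *
        (2⁻¹ * ∫⁻ p : Ω × Ω,
            (ENNReal.ofReal (Real.exp (t * max (h p.1 p.2) (h p.2 p.1))) +
              ENNReal.ofReal (Real.exp (-(t * max (h p.1 p.2) (h p.2 p.1)))))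
          ∂(μ.prod μ)) ^ N := by
  have hkm : Measurable (Function.uncurry fun x y : Ω => ENNReal.ofReal (Real.exp (-(t * h x y)))) :=
    ENNReal.measurable_ofReal.comp (Real.measurable_exp.comp (hmeas.const_mul t).neg)
  have hkinv : ∀ x y, (ENNReal.ofReal (Real.exp (-(t * h x y))))⁻¹ =
      ENNReal.ofReal (Real.exp (t * h x y)) := fun x y => by
    rw [← ENNReal.ofReal_inv_of_pos (Real.exp_pos _), Real.exp_neg, inv_inv]
  set W : Ω × Ω → ℝ≥0∞ := fun p =>
    ENNReal.ofReal (Real.exp (t * max (h p.1 p.2) (h p.2 p.1))) +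
      ENNReal.ofReal (Real.exp (-(t * max (h p.1 p.2) (h p.2 p.1)))) with hWdef
  have hW0 : 2⁻¹ * ∫⁻ p, W p ∂(μ.prod μ) ≠ 0 := by
    refine mul_ne_zero (by simp) (lt_of_lt_of_le one_pos ?_).ne'
    calc (1 : ℝ≥0∞) = ∫⁻ _ : Ω × Ω, 1 ∂(μ.prod μ) := by simp
      _ ≤ ∫⁻ p, W p ∂(μ.prod μ) := lintegral_mono fun p => by
        refine le_add_right ?_
        rw [ENNReal.one_le_ofReal, Real.one_le_exp_iff]
        exact mul_nonneg ht.le (le_max_of_le_left (hnn _ _))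
  obtain ⟨G, hGm, hGsup, hGint⟩ := exists_measurable_le_iSup_prod_kernel μ hkm
    (fun x y => by
      rw [ENNReal.ofReal_le_one, Real.exp_le_one_iff]
      exact neg_nonpos.2 (mul_nonneg ht.le (hnn _ _)))
    (fun x => by simp [hdiag]) (W := W)
    (fun x y a b ha hb hab => by
      rw [hkinv] at ha hb
      refine add_le_ofReal_exp_add_exp_neg
        (ha.trans (ENNReal.ofReal_le_ofReal (Real.exp_le_exp.2 ?_)))
        (hb.trans (ENNReal.ofReal_le_ofReal (Real.exp_le_exp.2 ?_))) hab
      · exact mul_le_mul_of_nonneg_left (le_max_left _ _) ht.le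
      · exact mul_le_mul_of_nonneg_left (le_max_right _ _) ht.le)
    hW0 N (Y := PUnit) (g := fun _ => A.indicator 1)
    ((measurable_one.indicator hA).comp measurable_snd)
    (fun _ x => Set.indicator_le_self' (by simp) x)
  refine iInf_le_of_le (fun x => (G ⟨⟩ x)⁻¹) <| iInf_le_of_le
    (hGm.comp (measurable_const.prodMk measurable_id)).inv <| iInf_le_of_le (fun x => ?_) ?_
  · rw [ENNReal.le_inv_iff_le_inv, ← ENNReal.ofReal_inv_of_pos (Real.exp_pos _), ← Real.exp_neg]
    refine (hGsup ⟨⟩ x).trans (iSup_le fun x' => ?_)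
    by_cases hx' : x' ∈ A
    · have hbdd : BddBelow (Set.range fun y : A => ∑ i, h (x i) ((y : Fin N → Ω) i)) :=
        ⟨0, by rintro _ ⟨y, rfl⟩; exact Finset.sum_nonneg fun i _ => hnn _ _⟩
      have hle : fPenalty h A x ≤ ∑ i, h (x i) (x' i) := ciInf_le hbdd ⟨x', hx'⟩
      rw [Set.indicator_of_mem hx', Pi.one_apply, mul_one,
        ← ENNReal.ofReal_prod_of_nonneg fun i _ => (Real.exp_pos _).le, ← Real.exp_sum,
        Finset.sum_neg_distrib, ← Finset.mul_sum]
      exact ENNReal.ofReal_le_ofReal (Real.exp_le_exp.2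
        (neg_le_neg (mul_le_mul_of_nonneg_left hle ht.le)))
    · simp [hx']
  · have := hGint ⟨⟩
    rw [lintegral_indicator_one hA, mul_comm] at this
    exact this
end

section
/- Let $\nu_1$ be the probability measure on $\mathbb{R}$ with density $\tfrac12 e^{-|x|}$ with respect to Lebesgue measure, and let $\varphi(x) = \min(|x|, x^2)$. There exists a universal constant $L > 0$ with the following property: for every nonincreasing function $f : \mathbb{R} \to \mathbb{R}$ with $f(0) = 0$ and Lipschitz constant at most $2/L$, defining $\widehat{f}(x) = \inf_{y \in \mathbb{R}} \big(f(y) + \tfrac1L \varphi(|x-y|)\big)$, one has $\Big(\int_{\mathbb{R}} e^{\widehat{f}}\, d\nu_1\Big)\Big(\int_{\mathbb{R}} e^{-f}\, d\nu_1\Big) \le 1$. -/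
open MeasureTheory ENNReal

/-- The two-sided exponential probability measure on `ℝ`, of density `(1/2) e^{-|x|}`
with respect to Lebesgue measure. -/
noncomputable def nuOne : Measure ℝ :=
  volume.withDensity fun x => ENNReal.ofReal (Real.exp (-|x|) / 2)

/-- `φ(x) = min(|x|, x²)`. -/
noncomputable def phi (x : ℝ) : ℝ := min |x| (x ^ 2)

open Set

/-- The one-sided exponential probability measure, of density `e^{-x}` on `(0, ∞)`. -/
noncomputable def halfExp : Measure ℝ :=
  (volume.restrict (Ioi 0)).withDensity fun x => ENNReal.ofReal (Real.exp (-x))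

lemma lintegral_halfExp {g : ℝ → ℝ≥0∞} (hg : Measurable g) :
    ∫⁻ x, g x ∂halfExp = ∫⁻ x in Ioi 0, ENNReal.ofReal (Real.exp (-x)) * g x := by
  rw [halfExp, lintegral_withDensity_eq_lintegral_mul _ (by fun_prop) hg]
  rfl

lemma halfExp_Ioi {a : ℝ} (ha : 0 ≤ a) : halfExp (Ioi a) = ENNReal.ofReal (Real.exp (-a)) := by
  rw [halfExp, withDensity_apply _ measurableSet_Ioi, Measure.restrict_restrict measurableSet_Ioi,
    inter_eq_left.2 (Ioi_subset_Ioi ha),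
    ← ofReal_integral_eq_lintegral_ofReal (integrableOn_exp_neg_Ioi a)
      (Filter.Eventually.of_forall fun x => (Real.exp_pos _).le),
    integral_exp_neg_Ioi]

lemma ae_halfExp_pos : ∀ᵐ x ∂halfExp, 0 < x :=
  (withDensity_absolutelyContinuous _ _).ae_le (ae_restrict_mem measurableSet_Ioi)

instance : IsProbabilityMeasure halfExp := by
  constructor
  have h : halfExp (Ioi 0) = halfExp univ := by
    apply measure_congr
    filter_upwards [ae_halfExp_pos] with x hx
    exact propext ⟨fun _ => trivial, fun _ => hx⟩
  rw [← h, halfExp_Ioi le_rfl]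
  simp

lemma integrable_exp_half : Integrable (fun x => Real.exp (x / 2)) halfExp := by
  rw [halfExp, integrable_withDensity_iff (by fun_prop) (by simp)]
  refine (exp_neg_integrableOn_Ioi 0 (b := 1 / 2) (by norm_num)).congr_fun (fun x _ => ?_)
    measurableSet_Ioi
  simp only
  rw [ENNReal.toReal_ofReal (Real.exp_pos _).le, ← Real.exp_add]
  ring_nf

/-- Monotone, `1/512`-Lipschitz functions vanishing at the origin. -/
structure IsSlow (F : ℝ → ℝ) : Prop where
  mono : Monotone F
  zero : F 0 = 0
  lip : ∀ x y, |F x - F y| ≤ 1 / 512 * |x - y|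

namespace IsSlow

variable {F : ℝ → ℝ}

lemma lipschitz (hF : IsSlow F) : LipschitzWith (1 / 512) F :=
  LipschitzWith.of_dist_le_mul fun x y => by
    simpa [Real.dist_eq] using hF.lip x y

lemma continuous (hF : IsSlow F) : Continuous F := hF.lipschitz.continuous

lemma nonneg (hF : IsSlow F) {x : ℝ} (hx : 0 ≤ x) : 0 ≤ F x := hF.zero ▸ hF.mono hx

lemma le_mul (hF : IsSlow F) {x : ℝ} (hx : 0 ≤ x) : F x ≤ x / 512 := by
  have := hF.lip x 0
  rw [hF.zero, sub_zero, sub_zero, abs_of_nonneg hx] at this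
  linarith [le_abs_self (F x)]

lemma sub_le (hF : IsSlow F) {x y : ℝ} (h : x ≤ y) : F y - F x ≤ (y - x) / 512 := by
  have := hF.lip y x
  rw [abs_of_nonneg (sub_nonneg.2 h)] at this
  linarith [le_abs_self (F y - F x)]

lemma deriv_nonneg (hF : IsSlow F) (x : ℝ) : 0 ≤ deriv F x := hF.mono.deriv_nonneg

lemma deriv_le (hF : IsSlow F) (x : ℝ) : deriv F x ≤ 1 / 512 := by
  have := norm_deriv_le_of_lipschitz (x₀ := x) hF.lipschitz
  have h2 : ‖deriv F x‖ ≤ 1 / 512 := by simpa using this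
  exact (le_abs_self _).trans h2

lemma ofReal_comp_eq (hF : IsSlow F) {P P' : ℝ → ℝ} (hP : ∀ x, HasDerivAt P (P' x) x)
    (hc : Continuous P') (h0 : P 0 = 0) (hn : ∀ x, 0 ≤ x → 0 ≤ P' x) {z : ℝ} (hz : 0 ≤ z) :
    ENNReal.ofReal (P (F z)) = ∫⁻ y in Ioi 0, ENNReal.ofReal (P' (F y) * deriv F y) *
      (Iio z).indicator 1 y := by
  have hP1 : ContDiff ℝ 1 P := by
    rw [contDiff_one_iff_deriv]
    refine ⟨fun x => (hP x).differentiableAt, ?_⟩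
    rwa [funext fun x => (hP x).deriv]
  have hloc : LocallyLipschitz (P ∘ F) :=
    hP1.locallyLipschitz.comp hF.lipschitz.locallyLipschitz
  obtain ⟨K, hK⟩ := hloc.locallyLipschitzOn.exists_lipschitzOnWith_of_compact
    (isCompact_uIcc (a := (0 : ℝ)) (b := z))
  have hac := hK.absolutelyContinuousOnInterval
  have hftc := hac.integral_deriv_eq_sub
  have hint := hac.intervalIntegrable_deriv
  have hae : ∀ᵐ y, deriv (P ∘ F) y = P' (F y) * deriv F y := by
    filter_upwards [hF.lipschitz.ae_differentiableAt_real] with y hy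
    exact ((hP (F y)).comp y hy.hasDerivAt).deriv
  simp only [Function.comp_apply, hF.zero, h0, sub_zero] at hftc
  rw [← hftc, intervalIntegral.integral_of_le hz, ofReal_integral_eq_lintegral_ofReal]
  · rw [lintegral_congr_ae (g := fun y => ENNReal.ofReal (P' (F y) * deriv F y))]
    · rw [← setLIntegral_congr (Ioo_ae_eq_Ioc (a := (0 : ℝ)) (b := z)), ← Ioi_inter_Iio,
        inter_comm, ← Measure.restrict_restrict measurableSet_Iio,
        ← lintegral_indicator measurableSet_Iio]
      refine lintegral_congr fun y => ?_
      by_cases hy : y < z <;> simp [hy]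
    · filter_upwards [ae_restrict_of_ae hae] with y hy
      rw [hy]
  · exact hint.1
  · filter_upwards [ae_restrict_of_ae hae, ae_restrict_mem measurableSet_Ioc] with y hy hy'
    rw [hy]
    exact mul_nonneg (hn _ (hF.nonneg hy'.1.le)) (hF.deriv_nonneg _)

lemma lintegral_comp_eq (hF : IsSlow F) {P P' : ℝ → ℝ} (hP : ∀ x, HasDerivAt P (P' x) x)
    (hc : Continuous P') (h0 : P 0 = 0) (hn : ∀ x, 0 ≤ x → 0 ≤ P' x) {T : ℝ → ℝ}
    (hT : Measurable T) (hT0 : ∀ x, 0 < x → 0 ≤ T x) :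
    ∫⁻ x, ENNReal.ofReal (P (F (T x))) ∂halfExp =
      ∫⁻ y in Ioi 0, ENNReal.ofReal (P' (F y) * deriv F y) * halfExp {x | y < T x} := by
  have hFm : Measurable F := hF.continuous.measurable
  have hm : Measurable fun y => ENNReal.ofReal (P' (F y) * deriv F y) :=
    ((hc.measurable.comp hFm).mul (measurable_deriv F)).ennreal_ofReal
  rw [lintegral_congr_ae (g := fun x => ∫⁻ y in Ioi 0, ENNReal.ofReal (P' (F y) * deriv F y) *
      (Iio (T x)).indicator 1 y)]
  · rw [lintegral_lintegral_swap]
    · refine lintegral_congr fun y => ?_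
      have hs : MeasurableSet {x | y < T x} := measurableSet_lt measurable_const hT
      rw [lintegral_const_mul, ← lintegral_indicator_one hs]
      · rfl
      · exact (measurable_one.indicator hs : Measurable ({x | y < T x}.indicator
          (1 : ℝ → ℝ≥0∞)))
    · refine Measurable.aemeasurable ?_
      refine (hm.comp measurable_snd).mul ?_
      exact (measurable_one.indicator (measurableSet_lt measurable_snd (hT.comp measurable_fst)) :
        Measurable ({p : ℝ × ℝ | p.2 < T p.1}.indicator (1 : ℝ × ℝ → ℝ≥0∞)))
  · filter_upwards [ae_halfExp_pos] with x hx
    exact hF.ofReal_comp_eq hP hc h0 hn (hT0 x hx)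

lemma integrable_of_le (hF : IsSlow F) {g : ℝ → ℝ} (hg : Measurable g)
    (hb : ∀ x, 0 < x → |g x| ≤ 8 * Real.exp (256 * F x)) : Integrable g halfExp := by
  refine (integrable_exp_half.const_mul 8).mono' hg.aestronglyMeasurable ?_
  filter_upwards [ae_halfExp_pos] with x hx
  refine (hb x hx).trans ?_
  have := hF.le_mul hx.le
  gcongr
  linarith

/-- Integration by parts against the exponential measure. -/
lemma integral_comp_eq (hF : IsSlow F) {P P' : ℝ → ℝ} (hP : ∀ x, HasDerivAt P (P' x) x)
    (hc : Continuous P') (h0 : P 0 = 0) (hn : ∀ x, 0 ≤ x → 0 ≤ P' x)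
    (hPn : ∀ x, 0 ≤ x → 0 ≤ P x) :
    ∫ x, P (F x) ∂halfExp = ∫ x, P' (F x) * deriv F x ∂halfExp := by
  have hFm : Measurable F := hF.continuous.measurable
  have hPc : Continuous P := continuous_iff_continuousAt.2 fun x => (hP x).continuousAt
  have hm : Measurable fun y => P' (F y) * deriv F y :=
    (hc.measurable.comp hFm).mul (measurable_deriv F)
  rw [integral_eq_lintegral_of_nonneg_ae, integral_eq_lintegral_of_nonneg_ae,
    hF.lintegral_comp_eq (T := fun x => x) hP hc h0 hn measurable_id fun x hx => hx.le,
    lintegral_halfExp hm.ennreal_ofReal]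
  · congr 1
    refine setLIntegral_congr_fun measurableSet_Ioi fun y hy => ?_
    have : {x | y < x} = Ioi y := rfl
    rw [this, halfExp_Ioi (mem_Ioi.1 hy).le, mul_comm]
  · filter_upwards [ae_halfExp_pos] with x hx
    exact mul_nonneg (hn _ (hF.nonneg hx.le)) (hF.deriv_nonneg _)
  · exact hm.aestronglyMeasurable
  · filter_upwards [ae_halfExp_pos] with x hx
    exact hPn _ (hF.nonneg hx.le)
  · exact (hPc.measurable.comp hFm).aestronglyMeasurable

lemma integral_comp_le (hF : IsSlow F) {P P' : ℝ → ℝ} (hP : ∀ x, HasDerivAt P (P' x) x)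
    (hc : Continuous P') (h0 : P 0 = 0) (hn : ∀ x, 0 ≤ x → 0 ≤ P' x)
    (hPn : ∀ x, 0 ≤ x → 0 ≤ P x) {T : ℝ → ℝ} (hT : Measurable T) (hT0 : ∀ x, 0 < x → 0 ≤ T x)
    {k : ℝ → ℝ} (hkm : Measurable k) (hk0 : ∀ y, 0 < y → 0 ≤ k y)
    (hk : ∀ y, 0 < y → halfExp {x | y < T x} ≤ ENNReal.ofReal (Real.exp (-y) * k y))
    (hi : Integrable (fun y => P' (F y) * deriv F y * k y) halfExp) :
    ∫ x, P (F (T x)) ∂halfExp ≤ ∫ y, P' (F y) * deriv F y * k y ∂halfExp := by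
  have hFm : Measurable F := hF.continuous.measurable
  have hPc : Continuous P := continuous_iff_continuousAt.2 fun x => (hP x).continuousAt
  have hm : Measurable fun y => P' (F y) * deriv F y * k y :=
    ((hc.measurable.comp hFm).mul (measurable_deriv F)).mul hkm
  have hnn : 0 ≤ᵐ[halfExp] fun y => P' (F y) * deriv F y * k y := by
    filter_upwards [ae_halfExp_pos] with x hx
    exact mul_nonneg (mul_nonneg (hn _ (hF.nonneg hx.le)) (hF.deriv_nonneg _)) (hk0 x hx)
  rw [← ENNReal.ofReal_le_ofReal_iff (integral_nonneg_of_ae hnn),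
    ofReal_integral_eq_lintegral_ofReal hi hnn, lintegral_halfExp hm.ennreal_ofReal,
    integral_eq_lintegral_of_nonneg_ae]
  · refine ENNReal.ofReal_toReal_le.trans ?_
    rw [hF.lintegral_comp_eq hP hc h0 hn hT hT0]
    refine setLIntegral_mono' measurableSet_Ioi fun y hy => ?_
    refine (mul_le_mul_right (hk y hy) _).trans_eq ?_
    have := mul_nonneg (hn _ (hF.nonneg (mem_Ioi.1 hy).le)) (hF.deriv_nonneg y)
    rw [← ENNReal.ofReal_mul this, ← ENNReal.ofReal_mul (Real.exp_pos _).le]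
    ring_nf
  · filter_upwards [ae_halfExp_pos] with x hx
    exact hPn _ (hF.nonneg (hT0 x hx))
  · exact (hPc.measurable.comp (hFm.comp hT)).aestronglyMeasurable

lemma le_integral_comp (hF : IsSlow F) {P P' : ℝ → ℝ} (hP : ∀ x, HasDerivAt P (P' x) x)
    (hc : Continuous P') (h0 : P 0 = 0) (hn : ∀ x, 0 ≤ x → 0 ≤ P' x)
    (hPn : ∀ x, 0 ≤ x → 0 ≤ P x) {T : ℝ → ℝ} (hT : Measurable T) (hT0 : ∀ x, 0 < x → 0 ≤ T x)
    {k : ℝ → ℝ} (hkm : Measurable k) (hk0 : ∀ y, 0 < y → 0 ≤ k y)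
    (hk : ∀ y, 0 < y → ENNReal.ofReal (Real.exp (-y) * k y) ≤ halfExp {x | y < T x})
    (hi : Integrable (fun x => P (F (T x))) halfExp) :
    ∫ y, P' (F y) * deriv F y * k y ∂halfExp ≤ ∫ x, P (F (T x)) ∂halfExp := by
  have hFm : Measurable F := hF.continuous.measurable
  have hm : Measurable fun y => P' (F y) * deriv F y * k y :=
    ((hc.measurable.comp hFm).mul (measurable_deriv F)).mul hkm
  have hnn : 0 ≤ᵐ[halfExp] fun y => P' (F y) * deriv F y * k y := by
    filter_upwards [ae_halfExp_pos] with x hx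
    exact mul_nonneg (mul_nonneg (hn _ (hF.nonneg hx.le)) (hF.deriv_nonneg _)) (hk0 x hx)
  have hnn' : 0 ≤ᵐ[halfExp] fun x => P (F (T x)) := by
    filter_upwards [ae_halfExp_pos] with x hx
    exact hPn _ (hF.nonneg (hT0 x hx))
  rw [← ENNReal.ofReal_le_ofReal_iff (integral_nonneg_of_ae hnn'),
    ofReal_integral_eq_lintegral_ofReal hi hnn',
    integral_eq_lintegral_of_nonneg_ae hnn hm.aestronglyMeasurable,
    lintegral_halfExp hm.ennreal_ofReal]
  refine ENNReal.ofReal_toReal_le.trans ?_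
  rw [hF.lintegral_comp_eq hP hc h0 hn hT hT0]
  refine setLIntegral_mono' measurableSet_Ioi fun y hy => ?_
  refine Eq.trans_le ?_ (mul_le_mul_right (hk y hy) _)
  have := mul_nonneg (hn _ (hF.nonneg (mem_Ioi.1 hy).le)) (hF.deriv_nonneg y)
  rw [← ENNReal.ofReal_mul this, ← ENNReal.ofReal_mul (Real.exp_pos _).le]
  ring_nf

/-- A product `F ^ n * e ^ (a F)` with moderate exponents is integrable, even after
multiplication by a bounded factor. -/
lemma integrable_pow_mul_exp (hF : IsSlow F) {n : ℕ} {a : ℝ} (hna : n + a ≤ 256) {g : ℝ → ℝ}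
    (hg : Measurable g) (hb : ∀ x, 0 < x → |g x| ≤ 8) :
    Integrable (fun x => F x ^ n * Real.exp (a * F x) * g x) halfExp := by
  have hFm : Measurable F := hF.continuous.measurable
  refine hF.integrable_of_le (by fun_prop) fun x hx => ?_
  have h0 := hF.nonneg hx.le
  have h1 : F x ^ n ≤ Real.exp (n * F x) := by
    rw [Real.exp_nat_mul]
    exact pow_le_pow_left₀ h0 (by linarith [Real.add_one_le_exp (F x)]) n
  rw [abs_mul, abs_of_nonneg (by positivity), mul_comm]
  refine mul_le_mul (hb x hx) ?_ (by positivity) (by norm_num)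
  calc F x ^ n * Real.exp (a * F x) ≤ Real.exp (n * F x) * Real.exp (a * F x) := by gcongr
    _ = Real.exp ((n + a) * F x) := by rw [← Real.exp_add]; ring_nf
    _ ≤ _ := by gcongr

lemma abs_deriv_le (hF : IsSlow F) (x : ℝ) : |deriv F x| ≤ 8 := by
  rw [abs_of_nonneg (hF.deriv_nonneg x)]
  linarith [hF.deriv_le x]

lemma integrable_pow (hF : IsSlow F) {n : ℕ} (hn : n ≤ 256) :
    Integrable (fun x => F x ^ n) halfExp := by
  have := hF.integrable_pow_mul_exp (n := n) (a := 0) (by simpa using (by exact_mod_cast hn))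
    (g := fun _ => 1) measurable_const (by norm_num)
  simpa using this

lemma integrable_pow_mul_deriv (hF : IsSlow F) {n : ℕ} (hn : n ≤ 256) :
    Integrable (fun x => F x ^ n * deriv F x) halfExp := by
  have := hF.integrable_pow_mul_exp (n := n) (a := 0) (by simpa using (by exact_mod_cast hn))
    (g := deriv F) (measurable_deriv F) fun x _ => hF.abs_deriv_le x
  simpa using this

lemma integral_pow_mul_deriv (hF : IsSlow F) (n : ℕ) :
    (n + 1) * ∫ x, F x ^ n * deriv F x ∂halfExp = ∫ x, F x ^ (n + 1) ∂halfExp := by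
  rw [hF.integral_comp_eq (P := fun u => u ^ (n + 1)) (P' := fun u => (n + 1) * u ^ n)
    (fun u => by simpa using hasDerivAt_pow (n + 1) u) (by fun_prop) (by simp)
    (fun u hu => by positivity) (fun u hu => by positivity), ← integral_const_mul]
  simp only [mul_assoc]

lemma integral_cube_le (hF : IsSlow F) :
    ∫ x, F x ^ 3 ∂halfExp ≤ 3 / 512 * ∫ x, F x ^ 2 ∂halfExp := by
  rw [← hF.integral_pow_mul_deriv 2, ← integral_const_mul, ← integral_const_mul]
  refine integral_mono ((hF.integrable_pow_mul_deriv (by norm_num)).const_mul _)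
    ((hF.integrable_pow (by norm_num)).const_mul _) fun x => ?_
  have := hF.deriv_le x
  have h2 := mul_le_mul_of_nonneg_left this (sq_nonneg (F x))
  push_cast
  nlinarith

lemma integrable_sq_mul_exp (hF : IsSlow F) :
    Integrable (fun x => F x ^ 2 * Real.exp (2 * F x)) halfExp := by
  simpa using hF.integrable_pow_mul_exp (n := 2) (a := 2) (by norm_num)
    (g := fun _ => 1) measurable_const (by norm_num)

lemma integral_sq_mul_exp_le (hF : IsSlow F) :
    ∫ x, F x ^ 2 * Real.exp (2 * F x) ∂halfExp ≤ 2 * ∫ x, F x ^ 2 ∂halfExp := by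
  have hexp : ∀ u : ℝ, HasDerivAt (fun u => Real.exp (2 * u)) (2 * Real.exp (2 * u)) u := fun u => by
    have := ((hasDerivAt_id u).const_mul 2).exp
    simpa [mul_comm] using this
  have hge : ∀ u : ℝ, 0 ≤ u → 1 ≤ Real.exp (2 * u) := fun u hu => Real.one_le_exp (by positivity)
  have key := hF.integral_comp_eq (P := fun u => u ^ 2 * (Real.exp (2 * u) - 1))
    (P' := fun u => 2 * u * (Real.exp (2 * u) - 1) + u ^ 2 * (2 * Real.exp (2 * u)))
    (fun u => ((hasDerivAt_pow 2 u).fun_mul ((hexp u).sub_const 1)).congr_deriv (by simp))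
    (by fun_prop) (by simp)
    (fun u hu => by have := sub_nonneg.2 (hge u hu); positivity)
    (fun u hu => by have := sub_nonneg.2 (hge u hu); positivity)
  have hI := hF.integrable_pow (n := 2) (by norm_num)
  have hJ := hF.integrable_sq_mul_exp
  have h1 : ∫ x, F x ^ 2 * (Real.exp (2 * F x) - 1) ∂halfExp =
      ∫ x, F x ^ 2 * Real.exp (2 * F x) ∂halfExp - ∫ x, F x ^ 2 ∂halfExp := by
    rw [← integral_sub hJ hI]
    simp only [mul_sub, mul_one]
  have h2 : ∫ x, (2 * F x * (Real.exp (2 * F x) - 1) + F x ^ 2 * (2 * Real.exp (2 * F x))) *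
      deriv F x ∂halfExp ≤ 6 / 512 * ∫ x, F x ^ 2 * Real.exp (2 * F x) ∂halfExp := by
    rw [← integral_const_mul]
    refine integral_mono_of_nonneg ?_ (hJ.const_mul _) ?_
    · filter_upwards [ae_halfExp_pos] with x hx
      have h0 := hF.nonneg hx.le
      have := sub_nonneg.2 (hge _ h0)
      have := hF.deriv_nonneg x
      simp only [Pi.zero_apply]
      positivity
    · filter_upwards [ae_halfExp_pos] with x hx
      have h0 := hF.nonneg hx.le
      have h3 : Real.exp (2 * F x) - 1 ≤ 2 * F x * Real.exp (2 * F x) := by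
        have h4 := Real.add_one_le_exp (-(2 * F x))
        have h5 : Real.exp (-(2 * F x)) * Real.exp (2 * F x) = 1 := by
          rw [← Real.exp_add]; simp
        nlinarith [Real.exp_pos (2 * F x)]
      have h6 : 2 * F x * (Real.exp (2 * F x) - 1) + F x ^ 2 * (2 * Real.exp (2 * F x)) ≤
          6 * (F x ^ 2 * Real.exp (2 * F x)) := by nlinarith
      calc _ ≤ 6 * (F x ^ 2 * Real.exp (2 * F x)) * (1 / 512) :=
            mul_le_mul h6 (hF.deriv_le x) (hF.deriv_nonneg x) (by positivity)
        _ = _ := by ring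
  have h3 : 0 ≤ ∫ x, F x ^ 2 ∂halfExp := integral_nonneg fun x => sq_nonneg _
  linarith

end IsSlow

lemma exp_sub_one_le_mul_exp (a : ℝ) : Real.exp a - 1 ≤ a * Real.exp a := by
  have h4 := Real.add_one_le_exp (-a)
  have h5 : Real.exp (-a) * Real.exp a = 1 := by rw [← Real.exp_add]; simp
  nlinarith [Real.exp_pos a]

lemma exp_add_exp_neg_le {u : ℝ} (hu : 0 ≤ u) :
    Real.exp u + Real.exp (-u) ≤ 2 + u ^ 2 * Real.exp (2 * u) := by
  have h1 : Real.exp u + Real.exp (-u) - 2 = Real.exp (-u) * (Real.exp u - 1) ^ 2 := by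
    have h5 : Real.exp (-u) * Real.exp u = 1 := by rw [← Real.exp_add]; simp
    linear_combination (-Real.exp u + 2) * h5
  have h2 := exp_sub_one_le_mul_exp u
  have h3 : 0 ≤ Real.exp u - 1 := by linarith [Real.one_le_exp hu]
  have h4 : (Real.exp u - 1) ^ 2 ≤ u ^ 2 * Real.exp (2 * u) := by
    calc _ ≤ (u * Real.exp u) ^ 2 := pow_le_pow_left₀ h3 h2 2
      _ = _ := by rw [mul_pow, ← Real.exp_nat_mul]; norm_num
  have h6 : Real.exp (-u) ≤ 1 := Real.exp_le_one_iff.2 (by linarith)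
  have := mul_le_mul h6 h4 (sq_nonneg _) zero_le_one
  linarith

lemma phi_nonneg (x : ℝ) : 0 ≤ phi x := le_min (abs_nonneg _) (sq_nonneg _)

lemma exp_phi_sub_one_le {u : ℝ} (hu : 0 ≤ u) :
    Real.exp (phi (64 * u) / 1024) - 1 ≤ 4 * u ^ 2 * Real.exp u := by
  refine (exp_sub_one_le_mul_exp _).trans ?_
  have h1 : phi (64 * u) / 1024 ≤ u := by
    have : phi (64 * u) ≤ |64 * u| := min_le_left _ _
    rw [abs_of_nonneg (by positivity)] at this
    linarith
  have h2 : phi (64 * u) / 1024 ≤ 4 * u ^ 2 := by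
    have : phi (64 * u) ≤ (64 * u) ^ 2 := min_le_right _ _
    linarith
  have h3 := phi_nonneg (64 * u)
  gcongr

lemma exp_neg_le_quadratic {v : ℝ} (hv : 0 ≤ v) : Real.exp (-v) ≤ 1 - v + v ^ 2 / 2 := by
  have h1 := Real.quadratic_le_exp_of_nonneg hv
  have h5 : Real.exp (-v) * Real.exp v = 1 := by rw [← Real.exp_add]; simp
  have h2 : 0 < 1 - v + v ^ 2 / 2 := by nlinarith [sq_nonneg (v - 1)]
  have h3 := mul_le_mul_of_nonneg_left h1 h2.le
  have h4 : 1 ≤ (1 - v + v ^ 2 / 2) * Real.exp v := by nlinarith [sq_nonneg (v ^ 2)]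
  exact le_of_mul_le_mul_right (h5.trans_le h4) (Real.exp_pos v)

lemma lintegral_halfExp_add_le {U V A B C : ℝ → ℝ} (hU : Measurable U) (hU0 : ∀ x, 0 ≤ U x)
    (hV0 : ∀ x, 0 ≤ V x) (hA : Integrable A halfExp) (hB : Integrable B halfExp)
    (hC : Integrable C halfExp) (h : ∀ x, 0 < x → U x + V x ≤ 2 + A x - B x + 5 * C x)
    (hc : ∫ x, A x ∂halfExp + 5 * ∫ x, C x ∂halfExp ≤ ∫ x, B x ∂halfExp) :
    ∫⁻ x, ENNReal.ofReal (U x) ∂halfExp + ∫⁻ x, ENNReal.ofReal (V x) ∂halfExp ≤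
      ENNReal.ofReal 2 := by
  have h2A : Integrable (fun x => 2 + A x) halfExp := (integrable_const 2).add hA
  have h2AB : Integrable (fun x => 2 + A x - B x) halfExp := h2A.sub hB
  have hR : Integrable (fun x => 2 + A x - B x + 5 * C x) halfExp := h2AB.add (hC.const_mul 5)
  have hR0 : 0 ≤ᵐ[halfExp] fun x => 2 + A x - B x + 5 * C x := by
    filter_upwards [ae_halfExp_pos] with x hx
    exact (add_nonneg (hU0 x) (hV0 x)).trans (h x hx)
  have hval : ∫ x, (2 + A x - B x + 5 * C x) ∂halfExp ≤ 2 := by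
    rw [integral_add h2AB (hC.const_mul 5), integral_sub h2A hB,
      integral_add (integrable_const 2) hA, integral_const_mul]
    simp only [integral_const, probReal_univ, one_smul]
    linarith
  rw [← lintegral_add_left hU.ennreal_ofReal]
  refine le_trans ?_ (ENNReal.ofReal_le_ofReal hval)
  rw [ofReal_integral_eq_lintegral_ofReal hR hR0]
  refine lintegral_mono_ae ?_
  filter_upwards [ae_halfExp_pos] with x hx
  rw [← ENNReal.ofReal_add (hU0 x) (hV0 x)]
  exact ENNReal.ofReal_le_ofReal (h x hx)

namespace IsSlow

variable {F : ℝ → ℝ}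

lemma lintegral_right_le (hF : IsSlow F) :
    ∫⁻ x, ENNReal.ofReal (Real.exp (-F (x + 64 * F x) + phi (64 * F x) / 1024)) ∂halfExp +
      ∫⁻ x, ENNReal.ofReal (Real.exp (F x)) ∂halfExp ≤ ENNReal.ofReal 2 := by
  have hFm : Measurable F := hF.continuous.measurable
  have hphi : Measurable phi := by unfold phi; fun_prop
  have hTm : Measurable fun x => x + 64 * F x := by fun_prop
  have hT : ∀ x, 0 < x → x ≤ x + 64 * F x := fun x hx => by linarith [hF.nonneg hx.le]
  have hP : ∀ u : ℝ, HasDerivAt (fun u => 1 - Real.exp (-u)) (Real.exp (-u)) u := fun u => by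
    simpa using ((hasDerivAt_neg u).exp).const_sub 1
  have hPn : ∀ u : ℝ, 0 ≤ u → 0 ≤ 1 - Real.exp (-u) := fun u hu =>
    sub_nonneg.2 (Real.exp_le_one_iff.2 (by linarith))
  have hle : ∀ u : ℝ, 0 ≤ u → |1 - Real.exp (-u)| ≤ 8 := fun u hu => by
    rw [abs_of_nonneg (hPn u hu)]
    linarith [Real.exp_pos (-u)]
  have hexp1 : ∀ x, 0 < x → (1 : ℝ) ≤ Real.exp (256 * F x) := fun x hx =>
    Real.one_le_exp (by linarith [hF.nonneg hx.le])
  have hi1 : Integrable (fun x => 1 - Real.exp (-F (x + 64 * F x))) halfExp :=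
    hF.integrable_of_le (by fun_prop) fun x hx => by
      linarith [hle _ (hF.nonneg (hx.le.trans (hT x hx))), hexp1 x hx]
  have hi2 : Integrable (fun x => 1 - Real.exp (-F x)) halfExp :=
    hF.integrable_of_le (by fun_prop) fun x hx => by
      linarith [hle _ (hF.nonneg hx.le), hexp1 x hx]
  have hJ := hF.integrable_sq_mul_exp
  have hi3 : Integrable (fun x => Real.exp (-F x) * deriv F x) halfExp := by
    simpa using hF.integrable_pow_mul_exp (n := 0) (a := -1) (by norm_num) (measurable_deriv F)
      fun x _ => hF.abs_deriv_le x
  have hi4 : Integrable (fun x => F x * Real.exp (-F x) * deriv F x) halfExp := by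
    simpa using hF.integrable_pow_mul_exp (n := 1) (a := -1) (by norm_num) (measurable_deriv F)
      fun x _ => hF.abs_deriv_le x
  have hlow := hF.le_integral_comp hP (by fun_prop) (by simp) (fun u _ => (Real.exp_pos _).le) hPn
    hTm (fun x hx => hx.le.trans (hT x hx)) (k := fun y => 1 + 512 / 9 * F y) (by fun_prop)
    (fun y hy => by have := hF.nonneg hy.le; positivity) (fun y hy => by
      have h0 := hF.nonneg hy.le
      have h1 := hF.le_mul hy.le
      have hsub : Ioi (y - 512 / 9 * F y) ⊆ {x | y < x + 64 * F x} := fun x hx => by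
        simp only [mem_Ioi, mem_ofPred_eq] at hx ⊢
        rcases le_total x y with h | h
        · have := hF.sub_le h
          linarith
        · rcases h.eq_or_lt with rfl | h
          · have : 0 < F y := by linarith
            linarith
          · linarith [hT x (hy.trans h)]
      refine le_trans ?_ (measure_mono hsub)
      rw [halfExp_Ioi (by linarith)]
      refine ENNReal.ofReal_le_ofReal ?_
      rw [neg_sub, sub_eq_neg_add, Real.exp_add]
      gcongr
      linarith [Real.add_one_le_exp (512 / 9 * F y)]) hi1
  have hibp := hF.integral_comp_eq hP (by fun_prop) (by simp) (fun u _ => (Real.exp_pos _).le) hPn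
  have hsplit : ∫ y, Real.exp (-F y) * deriv F y * (1 + 512 / 9 * F y) ∂halfExp =
      ∫ y, Real.exp (-F y) * deriv F y ∂halfExp +
        512 / 9 * ∫ y, F y * Real.exp (-F y) * deriv F y ∂halfExp := by
    rw [← integral_const_mul, ← integral_add hi3 (hi4.const_mul _)]
    congr 1 with y
    ring
  have hd1 : Integrable (fun x => F x * deriv F x) halfExp := by
    simpa using hF.integrable_pow_mul_deriv (n := 1) (by norm_num)
  have hd2 := hF.integrable_pow_mul_deriv (n := 2) (by norm_num)
  have hgain : ∫ x, F x * deriv F x ∂halfExp - ∫ x, F x ^ 2 * deriv F x ∂halfExp ≤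
      ∫ y, F y * Real.exp (-F y) * deriv F y ∂halfExp := by
    rw [← integral_sub hd1 hd2]
    refine integral_mono_ae (hd1.sub hd2) hi4 ?_
    filter_upwards [ae_halfExp_pos] with x hx
    have h0 := mul_nonneg (hF.nonneg hx.le) (hF.deriv_nonneg x)
    have := Real.add_one_le_exp (-F x)
    nlinarith
  have h1 := hF.integral_pow_mul_deriv 1
  have h2 := hF.integral_pow_mul_deriv 2
  norm_num at h1 h2
  have h3 := hF.integral_cube_le
  have h4 := hF.integral_sq_mul_exp_le
  have h5 : 0 ≤ ∫ x, F x ^ 2 ∂halfExp := integral_nonneg fun x => sq_nonneg _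
  have hpt : ∀ x, 0 < x → Real.exp (-F (x + 64 * F x) + phi (64 * F x) / 1024) + Real.exp (F x) ≤
      2 + (1 - Real.exp (-F x)) - (1 - Real.exp (-F (x + 64 * F x))) +
        5 * (F x ^ 2 * Real.exp (2 * F x)) := fun x hx => by
    have h0 := hF.nonneg hx.le
    have ha := exp_phi_sub_one_le h0
    have hb := exp_add_exp_neg_le h0
    have hc : Real.exp (-F (x + 64 * F x)) ≤ 1 :=
      Real.exp_le_one_iff.2 (by linarith [hF.nonneg (hx.le.trans (hT x hx))])
    have hd : 0 ≤ Real.exp (phi (64 * F x) / 1024) - 1 :=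
      sub_nonneg.2 (Real.one_le_exp (by linarith [phi_nonneg (64 * F x)]))
    have he : Real.exp (F x) ≤ Real.exp (2 * F x) := Real.exp_le_exp.2 (by linarith)
    have hf := mul_le_mul_of_nonneg_right hc hd
    have hg := mul_le_mul_of_nonneg_left he (sq_nonneg (F x))
    rw [Real.exp_add]
    linarith
  exact lintegral_halfExp_add_le (by fun_prop) (fun x => (Real.exp_pos _).le)
    (fun x => (Real.exp_pos _).le) hi2 hi1 hJ hpt (by linarith)

lemma lintegral_left_le (hF : IsSlow F) :
    ∫⁻ x, ENNReal.ofReal (Real.exp (F (x - 64 * F x) + phi (64 * F x) / 1024)) ∂halfExp +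
      ∫⁻ x, ENNReal.ofReal (Real.exp (-F x)) ∂halfExp ≤ ENNReal.ofReal 2 := by
  have hFm : Measurable F := hF.continuous.measurable
  have hphi : Measurable phi := by unfold phi; fun_prop
  have hTm : Measurable fun x => x - 64 * F x := by fun_prop
  have hT : ∀ x, 0 < x → x - 64 * F x ≤ x := fun x hx => by linarith [hF.nonneg hx.le]
  have hT0 : ∀ x, 0 < x → 0 ≤ x - 64 * F x := fun x hx => by linarith [hF.le_mul hx.le]
  have hP : ∀ u : ℝ, HasDerivAt (fun u => Real.exp u - 1) (Real.exp u) u := fun u =>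
    (Real.hasDerivAt_exp u).sub_const 1
  have hPn : ∀ u : ℝ, 0 ≤ u → 0 ≤ Real.exp u - 1 := fun u hu =>
    sub_nonneg.2 (Real.one_le_exp hu)
  have hle : ∀ x u : ℝ, 0 < x → 0 ≤ u → u ≤ F x →
      |Real.exp u - 1| ≤ 8 * Real.exp (256 * F x) := fun x u hx hu hux => by
    rw [abs_of_nonneg (hPn u hu)]
    have : Real.exp u ≤ Real.exp (256 * F x) :=
      Real.exp_le_exp.2 (by linarith [hF.nonneg hx.le])
    linarith [Real.exp_pos (256 * F x)]
  have hi1 : Integrable (fun x => Real.exp (F (x - 64 * F x)) - 1) halfExp :=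
    hF.integrable_of_le (by fun_prop) fun x hx =>
      hle x _ hx (hF.nonneg (hT0 x hx)) (hF.mono (hT x hx))
  have hi2 : Integrable (fun x => Real.exp (F x) - 1) halfExp :=
    hF.integrable_of_le (by fun_prop) fun x hx => hle x _ hx (hF.nonneg hx.le) le_rfl
  have hJ := hF.integrable_sq_mul_exp
  have hi3 : Integrable (fun x => Real.exp (F x) * deriv F x) halfExp := by
    simpa using hF.integrable_pow_mul_exp (n := 0) (a := 1) (by norm_num) (measurable_deriv F)
      fun x _ => hF.abs_deriv_le x
  have hi4 : Integrable (fun x => Real.exp (F x) * deriv F x * Real.exp (-(64 * F x))) halfExp := by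
    have := hF.integrable_pow_mul_exp (n := 0) (a := -63) (by norm_num) (measurable_deriv F)
      fun x _ => hF.abs_deriv_le x
    refine this.congr (Filter.Eventually.of_forall fun x => ?_)
    simp only [pow_zero, one_mul]
    rw [mul_right_comm, ← Real.exp_add]
    ring_nf
  have hup := hF.integral_comp_le hP (by fun_prop) (by simp) (fun u _ => (Real.exp_pos _).le) hPn
    hTm hT0 (k := fun y => Real.exp (-(64 * F y))) (by fun_prop)
    (fun y hy => (Real.exp_pos _).le) (fun y hy => by
      have h0 := hF.nonneg hy.le
      have hsub : {x | y < x - 64 * F x} ∩ Ioi 0 ⊆ Ioi (y + 64 * F y) := fun x hx => by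
        simp only [mem_inter_iff, mem_Ioi, mem_ofPred_eq] at hx ⊢
        have := hF.mono (hx.1.le.trans (hT x hx.2))
        linarith
      have hae : halfExp {x | y < x - 64 * F x} = halfExp ({x | y < x - 64 * F x} ∩ Ioi 0) := by
        refine measure_congr ?_
        filter_upwards [ae_halfExp_pos] with x hx
        exact propext ⟨fun h => ⟨h, hx⟩, fun h => h.1⟩
      rw [hae]
      refine (measure_mono hsub).trans_eq ?_
      rw [halfExp_Ioi (by linarith), neg_add, Real.exp_add]) hi4
  have hibp := hF.integral_comp_eq hP (by fun_prop) (by simp) (fun u _ => (Real.exp_pos _).le) hPn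
  have hd1 : Integrable (fun x => F x * deriv F x) halfExp := by
    simpa using hF.integrable_pow_mul_deriv (n := 1) (by norm_num)
  have hd2 := hF.integrable_pow_mul_deriv (n := 2) (by norm_num)
  have hgain : 64 * ∫ x, F x * deriv F x ∂halfExp - 2048 * ∫ x, F x ^ 2 * deriv F x ∂halfExp ≤
      ∫ x, Real.exp (F x) * deriv F x ∂halfExp -
        ∫ x, Real.exp (F x) * deriv F x * Real.exp (-(64 * F x)) ∂halfExp := by
    rw [← integral_const_mul, ← integral_const_mul,
      ← integral_sub (hd1.const_mul _) (hd2.const_mul _), ← integral_sub hi3 hi4]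
    refine integral_mono_ae ((hd1.const_mul _).sub (hd2.const_mul _)) (hi3.sub hi4) ?_
    filter_upwards [ae_halfExp_pos] with x hx
    have h0 := hF.nonneg hx.le
    have h1 := exp_neg_le_quadratic (v := 64 * F x) (by positivity)
    have h2 : Real.exp (-(64 * F x)) ≤ 1 := Real.exp_le_one_iff.2 (by linarith)
    have h3 := Real.one_le_exp h0
    have h4 := mul_le_mul_of_nonneg_right h3 (sub_nonneg.2 h2)
    have h5 : 64 * F x - 2048 * F x ^ 2 ≤ Real.exp (F x) * (1 - Real.exp (-(64 * F x))) := by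
      linarith
    have := mul_le_mul_of_nonneg_right h5 (hF.deriv_nonneg x)
    linarith
  have h1 := hF.integral_pow_mul_deriv 1
  have h2 := hF.integral_pow_mul_deriv 2
  norm_num at h1 h2
  have h3 := hF.integral_cube_le
  have h4 := hF.integral_sq_mul_exp_le
  have h5 : 0 ≤ ∫ x, F x ^ 2 ∂halfExp := integral_nonneg fun x => sq_nonneg _
  have hpt : ∀ x, 0 < x → Real.exp (F (x - 64 * F x) + phi (64 * F x) / 1024) + Real.exp (-F x) ≤
      2 + (Real.exp (F (x - 64 * F x)) - 1) - (Real.exp (F x) - 1) +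
        5 * (F x ^ 2 * Real.exp (2 * F x)) := fun x hx => by
    have h0 := hF.nonneg hx.le
    have ha := exp_phi_sub_one_le h0
    have hb := exp_add_exp_neg_le h0
    have hc : Real.exp (F (x - 64 * F x)) ≤ Real.exp (F x) := Real.exp_le_exp.2 (hF.mono (hT x hx))
    have hd : 0 ≤ Real.exp (phi (64 * F x) / 1024) - 1 :=
      sub_nonneg.2 (Real.one_le_exp (by linarith [phi_nonneg (64 * F x)]))
    have he : Real.exp (2 * F x) = Real.exp (F x) * Real.exp (F x) := by
      rw [← Real.exp_add, two_mul]
    have hf := mul_le_mul hc ha hd (Real.exp_pos _).le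
    rw [Real.exp_add]
    rw [he] at hb ⊢
    linarith
  exact lintegral_halfExp_add_le (by fun_prop) (fun x => (Real.exp_pos _).le)
    (fun x => (Real.exp_pos _).le) hi1 hi2 hJ hpt (by linarith)

end IsSlow

lemma lintegral_nuOne {g : ℝ → ℝ≥0∞} (hg : Measurable g) :
    ∫⁻ x, g x ∂nuOne = 2⁻¹ * (∫⁻ x, g x ∂halfExp + ∫⁻ x, g (-x) ∂halfExp) := by
  have hw : ∀ x : ℝ, ENNReal.ofReal (Real.exp (-|x|) / 2) =
      2⁻¹ * ENNReal.ofReal (Real.exp (-|x|)) := fun x => by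
    rw [div_eq_inv_mul, ENNReal.ofReal_mul (by norm_num), ENNReal.ofReal_inv_of_pos (by norm_num),
      ENNReal.ofReal_ofNat]
  have hm : Measurable fun x : ℝ => ENNReal.ofReal (Real.exp (-|x|)) * g x := by fun_prop
  rw [nuOne, lintegral_withDensity_eq_lintegral_mul _ (by fun_prop) hg]
  simp only [Pi.mul_apply, hw, mul_assoc]
  rw [lintegral_const_mul _ hm]
  congr 1
  rw [← lintegral_add_compl _ (measurableSet_Ioi (a := (0 : ℝ))), lintegral_halfExp hg,
    lintegral_halfExp (g := fun x => g (-x)) (by fun_prop), compl_Ioi]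
  congr 1
  · refine setLIntegral_congr_fun measurableSet_Ioi fun x hx => ?_
    simp only [abs_of_pos (mem_Ioi.1 hx)]
  · have hneg : ∫⁻ x in Iic (0 : ℝ), ENNReal.ofReal (Real.exp (-|x|)) * g x =
        ∫⁻ x in Ici (0 : ℝ), ENNReal.ofReal (Real.exp (-|x|)) * g (-x) := by
      have := (Measure.measurePreserving_neg (volume : Measure ℝ)).setLIntegral_comp_preimage
        (measurableSet_Iic (a := (0 : ℝ))) hm
      rw [← this]
      simp
    rw [hneg, ← setLIntegral_congr (Ioi_ae_eq_Ici (a := (0 : ℝ)))]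
    refine setLIntegral_congr_fun measurableSet_Ioi fun x hx => ?_
    simp only [abs_of_pos (mem_Ioi.1 hx)]

lemma ENNReal.mul_le_one_of_add_le_two {a b : ℝ≥0∞} (h : a + b ≤ 2) : a * b ≤ 1 := by
  have ha : a ≠ ∞ := ne_top_of_le_ne_top (by norm_num) (le_self_add.trans h)
  have hb : b ≠ ∞ := ne_top_of_le_ne_top (by norm_num) (le_add_self.trans h)
  lift a to NNReal using ha
  lift b to NNReal using hb
  norm_cast at h ⊢
  rw [← NNReal.coe_le_coe] at h ⊢
  push_cast at h ⊢
  nlinarith [sq_nonneg ((a : ℝ) - b), a.2, b.2]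

/-- Proposition 2.7.7 of Talagrand: there is a universal constant `L > 0` such that for
every nonincreasing `f : ℝ → ℝ` with `f(0) = 0` and Lipschitz constant at most `2/L`,
setting `f̂(x) = inf_y (f(y) + φ(|x-y|)/L)`, one has `(∫ e^{f̂} dν₁)(∫ e^{-f} dν₁) ≤ 1`.
(The integrand `e^{f̂(x)}` is expressed as `⨅ y, exp(f y + φ(|x-y|)/L)` in `ℝ≥0∞`,
which correctly handles the case `f̂(x) = -∞`.) -/
theorem talagrand_stmt8 :
    ∃ L : ℝ, 0 < L ∧
      ∀ f : ℝ → ℝ, Antitone f → f 0 = 0 →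
        (∀ x y : ℝ, |f x - f y| ≤ (2 / L) * |x - y|) →
        (∫⁻ x, ⨅ y : ℝ, ENNReal.ofReal (Real.exp (f y + phi |x - y| / L)) ∂nuOne) *
          (∫⁻ x, ENNReal.ofReal (Real.exp (-f x)) ∂nuOne) ≤ 1 := by
  refine ⟨1024, by norm_num, fun f hf h0 hlip => ?_⟩
  have hR : IsSlow fun x => -f x :=
    ⟨fun x y h => neg_le_neg (hf h), by simp [h0], fun x y => by
      have := hlip y x
      rw [abs_sub_comm y x] at this
      rw [neg_sub_neg]
      norm_num at this ⊢
      exact this⟩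
  have hL : IsSlow fun x => f (-x) :=
    ⟨fun x y h => hf (neg_le_neg h), by simp [h0], fun x y => by
      have := hlip (-x) (-y)
      rw [neg_sub_neg, abs_sub_comm y x] at this
      norm_num at this ⊢
      exact this⟩
  have hfm : Measurable f := hf.measurable
  have hphi : Measurable phi := by unfold phi; fun_prop
  set U : ℝ → ℝ≥0∞ := fun x =>
    ENNReal.ofReal (Real.exp (f (x + 64 * |f x|) + phi (64 * |f x|) / 1024)) with hU
  have hUm : Measurable U := by fun_prop
  have hle : ∫⁻ x, ⨅ y : ℝ, ENNReal.ofReal (Real.exp (f y + phi |x - y| / 1024)) ∂nuOne ≤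
      ∫⁻ x, U x ∂nuOne := by
    refine lintegral_mono fun x => ?_
    refine (iInf_le _ (x + 64 * |f x|)).trans_eq ?_
    rw [sub_add_cancel_left, abs_neg, abs_of_nonneg (a := 64 * |f x|) (by positivity)]
  refine (mul_le_mul' hle le_rfl).trans ?_
  apply ENNReal.mul_le_one_of_add_le_two
  rw [lintegral_nuOne hUm, lintegral_nuOne (by fun_prop), ← mul_add, add_add_add_comm]
  have e1 : ∫⁻ x, U x ∂halfExp = ∫⁻ x, ENNReal.ofReal
      (Real.exp (-(-f (x + 64 * -f x)) + phi (64 * -f x) / 1024)) ∂halfExp := by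
    refine lintegral_congr_ae ?_
    filter_upwards [ae_halfExp_pos] with x hx
    have := hf hx.le
    rw [h0] at this
    simp only [hU]
    rw [abs_of_nonpos this, neg_neg]
  have e2 : ∫⁻ x, U (-x) ∂halfExp = ∫⁻ x, ENNReal.ofReal
      (Real.exp (f (-(x - 64 * f (-x))) + phi (64 * f (-x)) / 1024)) ∂halfExp := by
    refine lintegral_congr_ae ?_
    filter_upwards [ae_halfExp_pos] with x hx
    have : 0 ≤ f (-x) := h0 ▸ hf (by linarith)
    simp only [hU]
    rw [abs_of_nonneg this, neg_sub, sub_eq_neg_add, add_comm (-x)]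
  rw [e1, e2]
  refine (mul_le_mul_right (add_le_add hR.lintegral_right_le hL.lintegral_left_le) _).trans_eq ?_
  rw [ENNReal.ofReal_ofNat, ← two_mul, ← mul_assoc, ENNReal.inv_mul_cancel (by norm_num)
    (by norm_num), one_mul]
end
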